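/- arXiv:2008.07692 — 2 statements merged into one kernel-verified Lean document; each statement's English description precedes it below -/
import Mathlib

section
/- Consider the family of planar vector fields X(x,y) = (-y, x) + Σ_{j=0}^{n} a_j X_j(x,y), where a = (a_0,...,a_n) ∈ ℝ^{n+1} and for each j, X_j = (f_j, g_j) is a fixed continuous homogeneous vector field of degree of homogeneity α_j ∈ ℝ with 0 ≤ α_0 < α_1 < ... < α_n. Define I_j = ∫_0^{2π} ( f_j(cos θ, sin θ) cos θ + g_j(cos θ, sin θ) sin θ ) dθ for j = 0,1,...,n, and let m + 1 be the number of indices j for which I_j ≠ 0. Then there exist values of a such that the planar differential system (ẋ, ẏ) = X(x,y) has at least m limit cycles. -/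
open Real Set

noncomputable section

/-- `φ` is a solution of the planar ODE `(ẋ,ẏ) = X(x,y)`. -/
def IsSolution (X : ℝ × ℝ → ℝ × ℝ) (φ : ℝ → ℝ × ℝ) : Prop :=
  ∀ t : ℝ, HasDerivAt φ (X (φ t)) t

/-- `φ` is a (non-constant) periodic orbit of the system `(ẋ,ẏ) = X(x,y)`. -/
def IsPeriodicOrbit (X : ℝ × ℝ → ℝ × ℝ) (φ : ℝ → ℝ × ℝ) : Prop :=
  IsSolution X φ ∧ (∃ T > 0, Function.Periodic φ T) ∧ ¬ (∃ c, ∀ t, φ t = c)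

/-- A limit cycle is a periodic orbit that is isolated in the set of all periodic
orbits: it has an open neighbourhood containing no other periodic orbit. -/
def IsLimitCycle (X : ℝ × ℝ → ℝ × ℝ) (φ : ℝ → ℝ × ℝ) : Prop :=
  IsPeriodicOrbit X φ ∧
  ∃ U : Set (ℝ × ℝ), IsOpen U ∧ Set.range φ ⊆ U ∧
    ∀ ψ : ℝ → ℝ × ℝ, IsPeriodicOrbit X ψ → Set.range ψ ⊆ U →
      Set.range ψ = Set.range φ

/-- The system `(ẋ,ẏ) = X(x,y)` has at least `N` (pairwise distinct) limit cycles. -/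
def HasAtLeastNLimitCycles (X : ℝ × ℝ → ℝ × ℝ) (N : ℕ) : Prop :=
  ∃ φ : Fin N → ℝ → ℝ × ℝ, (∀ i, IsLimitCycle X (φ i)) ∧
    ∀ i j, i ≠ j → Set.range (φ i) ≠ Set.range (φ j)

open Filter Topology MeasureTheory Metric

/-- Rolle for finite sets of zeros. -/
lemma aux_rolle (f f' : ℝ → ℝ) (hf : ∀ x, HasDerivAt f (f' x) x) (Z : Finset ℝ)
    (hZ : ∀ z ∈ Z, f z = 0) (k : ℕ) (hk : Z.card = k + 1) :
    ∃ W : Finset ℝ, W.card = k ∧ (∀ w ∈ W, f' w = 0) ∧ Disjoint W Z := by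
  classical
  let x := Z.orderEmbOfFin hk
  have hx : ∀ i, f (x i) = 0 := fun i => hZ _ (Finset.orderEmbOfFin_mem Z hk i)
  have hrolle : ∀ i : Fin k, ∃ c ∈ Ioo (x i.castSucc) (x i.succ), f' c = 0 := by
    intro i
    apply exists_hasDerivAt_eq_zero (f := f)
    · exact x.strictMono (Fin.castSucc_lt_succ)
    · exact fun y _ => (hf y).continuousAt.continuousWithinAt
    · rw [hx, hx]
    · exact fun y _ => hf y
  choose y hy hy0 using hrolle
  have hmono : StrictMono y := by
    intro i j hij
    have h1 : x i.succ ≤ x j.castSucc := by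
      apply x.monotone
      rw [Fin.le_def]; simpa using hij
    linarith [(hy i).2, (hy j).1]
  refine ⟨Finset.univ.image y, ?_, ?_, ?_⟩
  · rw [Finset.card_image_of_injective _ hmono.injective]; simp
  · intro w hw
    obtain ⟨i, -, rfl⟩ := Finset.mem_image.1 hw
    exact hy0 i
  · rw [Finset.disjoint_left]
    intro w hw hwZ
    obtain ⟨i, -, rfl⟩ := Finset.mem_image.1 hw
    have : y i ∈ Set.range x := by
      rw [Finset.range_orderEmbOfFin]; exact hwZ
    obtain ⟨j, hj⟩ := this
    have h := hy i
    rw [← hj] at h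
    have h1 := x.lt_iff_lt.1 h.1
    have h2 := x.lt_iff_lt.1 h.2
    rw [Fin.lt_def] at h1 h2
    simp at h1 h2
    omega

lemma aux_hasDeriv_expsum {ι : Type*} (J : Finset ι) (c β : ι → ℝ) (s : ℝ) :
    HasDerivAt (fun s => ∑ j ∈ J, c j * exp (β j * s)) (∑ j ∈ J, c j * β j * exp (β j * s)) s := by
  apply HasDerivAt.fun_sum
  intro j _
  have h : HasDerivAt (fun s => exp (β j * s)) (exp (β j * s) * (β j * 1)) s :=
    ((hasDerivAt_id s).const_mul (β j)).exp
  convert! h.const_mul (c j) using 1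
  ring

lemma aux_expsum_shift {ι : Type*} (J : Finset ι) (c β : ι → ℝ) (s b : ℝ) :
    ∑ j ∈ J, c j * exp ((β j - b) * s) = exp (-b * s) * ∑ j ∈ J, c j * exp (β j * s) := by
  rw [Finset.mul_sum]
  refine Finset.sum_congr rfl fun j _ => ?_
  rw [show (β j - b) * s = -b * s + β j * s by ring, exp_add]; ring

/-- Exponential sums form a Chebyshev system. -/
lemma aux_chebyshev {ι : Type*} [DecidableEq ι] (k : ℕ) :
    ∀ (J : Finset ι) (c β : ι → ℝ) (Z : Finset ℝ), Function.Injective β → J.card = k →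
      k ≤ Z.card → (∀ z ∈ Z, ∑ j ∈ J, c j * exp (β j * z) = 0) → ∀ j ∈ J, c j = 0 := by
  induction k with
  | zero =>
    intro J c β Z _ hJ _ _ j hj
    rw [Finset.card_eq_zero] at hJ
    simp [hJ] at hj
  | succ k ih =>
    intro J c β Z hβ hJ hZ h0
    obtain ⟨j0, hj0⟩ : J.Nonempty := by rw [← Finset.card_pos]; omega
    obtain ⟨Z', hZ'Z, hZ'⟩ := Finset.exists_subset_card_eq hZ
    obtain ⟨W, hW, hW0, -⟩ := aux_rolle _ _
      (aux_hasDeriv_expsum J c (fun j => β j - β j0)) Z'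
      (fun z hz => by rw [aux_expsum_shift, h0 z (hZ'Z hz), mul_zero]) k hZ'
    have h1 := ih (J.erase j0) (fun j => c j * (β j - β j0)) (fun j => β j - β j0) W
      (fun a b hab => hβ (by simpa using hab)) (by rw [Finset.card_erase_of_mem hj0, hJ]; rfl)
      hW.ge (fun w hw => by
        rw [← hW0 w hw]
        rw [← Finset.add_sum_erase J _ hj0]; simp)
    have h2 : ∀ j ∈ J, j ≠ j0 → c j = 0 := by
      intro j hj hne
      have := h1 j (Finset.mem_erase.2 ⟨hne, hj⟩)
      rcases mul_eq_zero.1 this with h | h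
      · exact h
      · exact absurd (hβ (sub_eq_zero.1 h)) hne
    intro j hj
    by_cases hne : j = j0
    · subst hne
      obtain ⟨z, hz⟩ : Z.Nonempty := by rw [← Finset.card_pos]; omega
      have := h0 z hz
      rw [Finset.sum_eq_single_of_mem j hj (fun i hi hne => by rw [h2 i hi hne, zero_mul])] at this
      exact (mul_eq_zero.1 this).resolve_right (exp_pos _).ne'
    · exact h2 j hj hne

/-- There is an exponential sum with `m+1` terms with `m` simple zeros. -/
lemma aux_simple_zeros {ι : Type*} [DecidableEq ι] (J : Finset ι) (β : ι → ℝ)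
    (hβ : Function.Injective β) (m : ℕ) (hJ : J.card = m + 1) :
    ∃ c : ι → ℝ, ∀ i : Fin m, ∑ j ∈ J, c j * exp (β j * (i : ℕ)) = 0 ∧
      ∑ j ∈ J, c j * β j * exp (β j * (i : ℕ)) ≠ 0 := by
  classical
  let L : (J → ℝ) →ₗ[ℝ] (Fin m → ℝ) :=
    { toFun := fun c i => ∑ j : J, c j * exp (β j * (i : ℕ))
      map_add' := by
        intro c d; ext i; simp [add_mul, Finset.sum_add_distrib]
      map_smul' := by
        intro r c; ext i; simp [mul_assoc, Finset.mul_sum] }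
  have hker : LinearMap.ker L ≠ ⊥ := by
    apply LinearMap.ker_ne_bot_of_finrank_lt
    simp [hJ]
  obtain ⟨c0, hc0, hne⟩ := (Submodule.ne_bot_iff _).1 hker
  let c : ι → ℝ := fun j => if h : j ∈ J then c0 ⟨j, h⟩ else 0
  have hcJ : ∀ j : J, c j = c0 j := by intro j; simp [c]
  have hz : ∀ i : Fin m, ∑ j ∈ J, c j * exp (β j * (i : ℕ)) = 0 := by
    intro i
    have : L c0 i = 0 := by rw [LinearMap.mem_ker.1 hc0]; rfl
    rw [← Finset.sum_coe_sort]
    simp only [hcJ]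
    exact this
  refine ⟨c, fun i => ⟨hz i, fun hd => hne ?_⟩⟩
  -- Suppose a double zero
  obtain ⟨j0, hj0⟩ : J.Nonempty := by rw [← Finset.card_pos]; omega
  let Z : Finset ℝ := Finset.univ.image (fun i : Fin m => ((i : ℕ) : ℝ))
  have hZc : Z.card = m := by
    rw [Finset.card_image_of_injective]
    · simp
    · intro a b hab
      have hab' : ((a : ℕ) : ℝ) = ((b : ℕ) : ℝ) := hab
      exact Fin.ext (by exact_mod_cast hab')
  have hZ0 : ∀ z ∈ Z, ∑ j ∈ J, c j * exp (β j * z) = 0 := by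
    intro z hz'
    obtain ⟨i, -, rfl⟩ := Finset.mem_image.1 hz'
    exact hz i
  obtain ⟨m', rfl⟩ : ∃ m', m = m' + 1 := ⟨m - 1, by have := i.2; omega⟩
  obtain ⟨W, hW, hW0, hdis⟩ := aux_rolle _ _
      (aux_hasDeriv_expsum J c (fun j => β j - β j0)) Z
      (fun z hz => by rw [aux_expsum_shift, hZ0 z hz, mul_zero]) m' hZc
  have hiZ : ((i : ℕ) : ℝ) ∈ Z := Finset.mem_image.2 ⟨i, Finset.mem_univ _, rfl⟩
  have hiW : ((i : ℕ) : ℝ) ∉ W := fun h => Finset.disjoint_left.1 hdis h hiZ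
  have hi0 : ∑ j ∈ J, c j * (β j - β j0) * exp ((β j - β j0) * (i : ℕ)) = 0 := by
    rw [aux_expsum_shift J (fun j => c j * (β j - β j0)) β]
    have : ∑ j ∈ J, c j * (β j - β j0) * exp (β j * (i : ℕ)) = 
        ∑ j ∈ J, c j * β j * exp (β j * (i : ℕ)) - β j0 * ∑ j ∈ J, c j * exp (β j * (i : ℕ)) := by
      rw [Finset.mul_sum, ← Finset.sum_sub_distrib]
      exact Finset.sum_congr rfl fun j _ => by ring
    rw [this, hd, hz i]; simp
  have h1 := aux_chebyshev (m' + 1) (J.erase j0) (fun j => c j * (β j - β j0))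
      (fun j => β j - β j0) (insert ((i : ℕ) : ℝ) W)
      (fun a b hab => hβ (by simpa using hab)) (by rw [Finset.card_erase_of_mem hj0, hJ]; rfl)
      (by rw [Finset.card_insert_of_notMem hiW, hW]) (fun w hw => by
        have key : ∑ j ∈ J, c j * (β j - β j0) * exp ((β j - β j0) * w) = 0 := by
          rcases Finset.mem_insert.1 hw with rfl | hw
          · exact hi0
          · exact hW0 w hw
        rw [← key, ← Finset.add_sum_erase J _ hj0]; simp)
  have h2 : ∀ j ∈ J, j ≠ j0 → c j = 0 := by
    intro j hj hne
    rcases mul_eq_zero.1 (h1 j (Finset.mem_erase.2 ⟨hne, hj⟩)) with h | h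
    · exact h
    · exact absurd (hβ (sub_eq_zero.1 h)) hne
  have h3 : c j0 = 0 := by
    have := hz i
    rw [Finset.sum_eq_single_of_mem j0 hj0 (fun i hi hne => by rw [h2 i hi hne, zero_mul])] at this
    exact (mul_eq_zero.1 this).resolve_right (exp_pos _).ne'
  ext j
  rw [← hcJ]
  by_cases hj : (j : ι) = j0
  · rw [hj, h3]; rfl
  · exact h2 j j.2 hj

/-- Flow for a scalar equation. -/
lemma aux_flow {f : ℝ → ℝ → ℝ} {tmin tmax : ℝ} {t₀ : Icc tmin tmax} {x₀ : ℝ} {a r L K : NNReal}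
    (hf : IsPicardLindelof f t₀ x₀ a r L K) :
    ∃ ρ : ℝ → ℝ → ℝ, (∀ x ∈ closedBall x₀ r, Continuous (ρ x) ∧
      (∀ t, ρ x t ∈ closedBall x₀ a) ∧
      (∀ t ∈ Icc tmin tmax, ρ x t = x + ∫ τ in (t₀ : ℝ)..t, f τ (ρ x τ))) ∧
      ∀ t ∈ Icc tmin tmax, ContinuousOn (fun x => ρ x t) (closedBall x₀ r) := by
  classical
  have this (x) (hx : x ∈ closedBall x₀ r) := ODE.FunSpace.exists_isFixedPt_next hf hx
  choose α hα using this
  refine ⟨fun x => if hx : x ∈ closedBall x₀ r then (α x hx).compProj else 0, ?_, ?_⟩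
  · intro x hx
    simp only [dif_pos hx]
    refine ⟨(α x hx).continuous_compProj, fun t => (α x hx).compProj_mem_closedBall hf.mul_max_le,
      fun t ht => ?_⟩
    rw [ODE.FunSpace.compProj_of_mem ht]
    nth_rewrite 1 [← hα x hx]
    rw [ODE.FunSpace.next_apply]
    rfl
  · obtain ⟨L', hL'⟩ := ODE.FunSpace.exists_forall_closedBall_funSpace_dist_le_mul hf
    intro t ht
    apply LipschitzOnWith.continuousOn (K := L')
    apply LipschitzOnWith.of_dist_le_mul
    intro x hx y hy
    simp only [dif_pos hx, dif_pos hy]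
    refine le_trans ?_ (hL' x y hx hy _ _ (hα x hx) (hα y hy))
    rw [ODE.FunSpace.compProj_of_mem ht, ODE.FunSpace.compProj_of_mem ht]
    exact ContinuousMap.dist_apply_le_dist (f := ODE.FunSpace.toContinuousMap (α x hx))
      (g := ODE.FunSpace.toContinuousMap (α y hy)) ⟨t, ht⟩

/-- Extending a closed-up integral curve periodically. -/
lemma aux_extend (h : ℝ → ℝ → ℝ) (S δ ε x : ℝ) (ρ : ℝ → ℝ)
    (hper : ∀ s θ, h s (θ + 2 * π) = h s θ)
    (hcont : ContinuousOn (fun p : ℝ × ℝ => h p.1 p.2) (closedBall S δ ×ˢ univ))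
    (hρ : Continuous ρ) (hmem : ∀ t, ρ t ∈ closedBall S δ)
    (hInt : ∀ t ∈ Icc 0 (2 * π), ρ t = x + ∫ τ in (0:ℝ)..t, ε * h (ρ τ) τ)
    (hclose : ρ (2 * π) = x) :
    ∃ σ : ℝ → ℝ, (∀ θ, σ (θ + 2 * π) = σ θ) ∧ (∀ θ, HasDerivAt σ (ε * h (σ θ) θ) θ) ∧
      ∀ θ, ∃ t ∈ Icc 0 (2 * π), σ θ = ρ t := by
  have hpi : 0 < 2 * π := by positivity
  have : Fact (0 < 2 * π) := ⟨hpi⟩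
  have hρ0 : ρ 0 = x := by simpa using hInt 0 ⟨le_rfl, hpi.le⟩
  let R : ℝ → ℝ := fun θ => AddCircle.liftIco (2 * π) 0 ρ (θ : AddCircle (2 * π))
  have hRc : Continuous R :=
    (AddCircle.liftIco_zero_continuous (by rw [hρ0, hclose]) hρ.continuousOn).comp
      (AddCircle.continuous_mk' _)
  have hRp : Function.Periodic R (2 * π) := by
    intro θ
    simp only [R, AddCircle.coe_add_period]
  have hRe : ∀ θ ∈ Ico 0 (2 * π), R θ = ρ θ := fun θ hθ => AddCircle.liftIco_zero_coe_apply hθ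
  have hRe' : ∀ θ ∈ Icc 0 (2 * π), R θ = ρ θ := by
    intro θ hθ
    rcases hθ.2.lt_or_eq with h1 | h1
    · exact hRe θ ⟨hθ.1, h1⟩
    · rw [h1, hclose, ← hρ0, ← hRe 0 ⟨le_rfl, hpi⟩, ← hRp 0, zero_add]
  have hRex : ∀ θ, ∃ t ∈ Ico 0 (2 * π), R θ = ρ t := by
    intro θ
    obtain ⟨t, ht, he⟩ := hRp.exists_mem_Ico₀ hpi θ
    exact ⟨t, ht, by rw [he, hRe t ht]⟩
  let g : ℝ → ℝ := fun θ => ε * h (R θ) θ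
  have hg : Continuous g := by
    apply continuous_const.mul
    have : Continuous (fun θ => (R θ, θ)) := by fun_prop
    refine hcont.comp_continuous this ?_
    intro θ
    refine ⟨?_, mem_univ _⟩
    obtain ⟨t, -, he⟩ := hRex θ
    show R θ ∈ _
    rw [he]; exact hmem t
  have hgp : Function.Periodic g (2 * π) := by
    intro θ
    simp only [g, hRp θ, hper]
  have hgi : ∀ t ∈ Icc 0 (2 * π), ∫ τ in (0:ℝ)..t, g τ = ρ t - x := by
    intro t ht
    rw [hInt t ht, add_sub_cancel_left]
    apply intervalIntegral.integral_congr
    intro τ hτ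
    rw [uIcc_of_le ht.1] at hτ
    simp only [g, hRe' τ ⟨hτ.1, hτ.2.trans ht.2⟩]
  let σ : ℝ → ℝ := fun θ => x + ∫ τ in (0:ℝ)..θ, g τ
  have hσp : Function.Periodic σ (2 * π) := by
    intro θ
    simp only [σ]
    rw [← intervalIntegral.integral_add_adjacent_intervals (hg.intervalIntegrable 0 θ)
      (hg.intervalIntegrable θ (θ + 2 * π)), hgp.intervalIntegral_add_eq θ 0, zero_add,
      hgi _ ⟨hpi.le, le_rfl⟩, hclose]
    ring
  have hσR : ∀ θ, σ θ = R θ := by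
    intro θ
    have hprod : Function.Periodic (fun y => (R y, σ y)) (2 * π) := fun y => by
      show (R (y + 2 * π), σ (y + 2 * π)) = (R y, σ y)
      rw [hRp y, hσp y]
    obtain ⟨t, ht, he⟩ := hprod.exists_mem_Ico₀ hpi θ
    have h1 : R θ = R t := congrArg Prod.fst he
    have h2 : σ θ = σ t := congrArg Prod.snd he
    rw [h1, h2, hRe t ht]
    simp only [σ]
    rw [hgi t ⟨ht.1, ht.2.le⟩]; ring
  refine ⟨σ, hσp, ?_, ?_⟩
  · intro θ
    rw [hσR θ]
    exact (hg.integral_hasStrictDerivAt 0 θ).hasDerivAt.const_add x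
  · intro θ
    obtain ⟨t, ht, he⟩ := hRex θ
    exact ⟨t, ⟨ht.1, ht.2.le⟩, by rw [hσR, he]⟩

/-- Existence of a periodic solution. -/
lemma aux_exist (h : ℝ → ℝ → ℝ) (k g : ℝ → ℝ) (S δ δ' ε M N η κ lam : ℝ)
    (hper : ∀ s θ, h s (θ + 2 * π) = h s θ)
    (hcont : ContinuousOn (fun p : ℝ × ℝ => h p.1 p.2) (closedBall S δ ×ˢ univ))
    (hM : ∀ s ∈ closedBall S δ, ∀ θ, |h s θ| ≤ M)
    (hk : Continuous k) (hg : Continuous g) (hN : ∀ θ, |k θ| ≤ N)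
    (hη : 0 ≤ η) (hδ : 0 < δ) (hM0 : 0 ≤ M) (hδ' : 0 < δ') (hε : 0 < ε)
    (hlip : ∀ s ∈ closedBall S δ, ∀ u ∈ closedBall S δ, ∀ θ,
      |h s θ - h u θ - k θ * (s - u)| ≤ η * |s - u|)
    (hgκ : ∀ θ, |h S θ - g θ| ≤ κ)
    (hg0 : ∫ θ in (0:ℝ)..(2 * π), g θ = 0)
    (hk0 : ∫ θ in (0:ℝ)..(2 * π), k θ = lam)
    (h1 : 2 * π * (ε * M) < δ - δ')
    (h2 : 2 * π * (η * δ' + (η + N) * (2 * π * (ε * M)) + κ) < |lam| * δ') :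
    ∃ σ : ℝ → ℝ, (∀ θ, σ (θ + 2 * π) = σ θ) ∧ (∀ θ, HasDerivAt σ (ε * h (σ θ) θ) θ) ∧
      ∀ θ, |σ θ - S| < δ := by
  have hpi : 0 < 2 * π := by positivity
  have hN0 : 0 ≤ N := (abs_nonneg _).trans (hN 0)
  have hLL : 0 ≤ ε * M := by positivity
  have hδle : δ' < δ := by nlinarith
  have hPL : IsPicardLindelof (fun t x => ε * h x t) (tmin := 0) (tmax := 2 * π)
      ⟨0, le_rfl, hpi.le⟩ S (⟨δ, hδ.le⟩ : NNReal) (⟨δ', hδ'.le⟩ : NNReal)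
      (⟨ε * M, hLL⟩ : NNReal) (⟨ε * (N + η), by positivity⟩ : NNReal) := by
    refine ⟨?_, ?_, ?_, ?_⟩
    · intro t _
      apply LipschitzOnWith.of_dist_le_mul
      intro s hs u hu
      have h3 := hlip s hs u hu t
      rw [Real.dist_eq, Real.dist_eq]
      show |ε * h s t - ε * h u t| ≤ ε * (N + η) * |s - u|
      rw [← mul_sub, abs_mul, abs_of_pos hε, mul_assoc]
      apply mul_le_mul_of_nonneg_left _ hε.le
      have h4 : |h s t - h u t| ≤ |h s t - h u t - k t * (s - u)| + |k t * (s - u)| := by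
        simpa using abs_add_le (h s t - h u t - k t * (s - u)) (k t * (s - u))
      rw [abs_mul] at h4
      nlinarith [mul_le_mul_of_nonneg_right (hN t) (abs_nonneg (s - u))]
    · intro s hs
      apply Continuous.continuousOn
      apply continuous_const.mul
      exact hcont.comp_continuous (f := fun t => (s, t)) (by fun_prop) (fun t => ⟨hs, mem_univ _⟩)
    · intro t _ s hs
      show |ε * h s t| ≤ ε * M
      rw [abs_mul, abs_of_pos hε]
      exact mul_le_mul_of_nonneg_left (hM s hs t) hε.le
    · show ε * M * max (2 * π - 0) (0 - 0) ≤ δ - δ'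
      rw [sub_zero, sub_zero, max_eq_left hpi.le]
      linarith
  obtain ⟨ρ, hρ, hρc⟩ := aux_flow hPL
  change ∀ x ∈ closedBall S δ', Continuous (ρ x) ∧ (∀ t, ρ x t ∈ closedBall S δ) ∧
      (∀ t ∈ Icc 0 (2 * π), ρ x t = x + ∫ τ in (0:ℝ)..t, ε * h (ρ x τ) τ) at hρ
  change ∀ t ∈ Icc 0 (2 * π), ContinuousOn (fun x => ρ x t) (closedBall S δ') at hρc
  have hhc : ∀ x ∈ closedBall S δ', Continuous (fun τ => h (ρ x τ) τ) := by
    intro x hx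
    exact hcont.comp_continuous (f := fun t => (ρ x t, t)) (by have := (hρ x hx).1; fun_prop)
      (fun t => ⟨(hρ x hx).2.1 t, mem_univ _⟩)
  have hdist : ∀ x ∈ closedBall S δ', ∀ t ∈ Icc 0 (2 * π), |ρ x t - x| ≤ 2 * π * (ε * M) := by
    intro x hx t ht
    rw [(hρ x hx).2.2 t ht, add_sub_cancel_left]
    have := intervalIntegral.norm_integral_le_of_norm_le_const (a := 0) (b := t) (C := ε * M)
      (f := fun τ => ε * h (ρ x τ) τ) (fun τ _ => by
        rw [Real.norm_eq_abs, abs_mul, abs_of_pos hε]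
        exact mul_le_mul_of_nonneg_left (hM _ ((hρ x hx).2.1 τ) τ) hε.le)
    rw [Real.norm_eq_abs] at this
    refine this.trans ?_
    rw [sub_zero, abs_of_nonneg ht.1, mul_comm]
    exact mul_le_mul_of_nonneg_right ht.2 hLL
  set C := η * δ' + (η + N) * (2 * π * (ε * M)) + κ with hC
  have hSδ : S ∈ closedBall S δ := mem_closedBall_self hδ.le
  have hmain : ∀ x ∈ closedBall S δ',
      |(∫ τ in (0:ℝ)..(2 * π), h (ρ x τ) τ) - lam * (x - S)| ≤ 2 * π * C := by
    intro x hx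
    have e1 : (∫ τ in (0:ℝ)..(2 * π), h (ρ x τ) τ) - lam * (x - S) =
        ∫ τ in (0:ℝ)..(2 * π), (h (ρ x τ) τ - g τ - k τ * (x - S)) := by
      rw [intervalIntegral.integral_sub, intervalIntegral.integral_sub, hg0, sub_zero,
        intervalIntegral.integral_mul_const, hk0]
      · exact (hhc x hx).intervalIntegrable _ _
      · exact hg.intervalIntegrable _ _
      · exact ((hhc x hx).sub hg).intervalIntegrable _ _
      · exact (hk.mul continuous_const).intervalIntegrable _ _
    rw [e1]
    have := intervalIntegral.norm_integral_le_of_norm_le_const (a := 0) (b := 2 * π) (C := C)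
      (f := fun τ => h (ρ x τ) τ - g τ - k τ * (x - S)) (fun τ hτ => by
        rw [uIoc_of_le hpi.le] at hτ
        have a1 := hlip _ ((hρ x hx).2.1 τ) S hSδ τ
        have a2 := hgκ τ
        have a3 := hdist x hx τ ⟨hτ.1.le, hτ.2⟩
        have a4 : |x - S| ≤ δ' := by rw [← Real.dist_eq]; exact hx
        have a5 : |ρ x τ - S| ≤ |ρ x τ - x| + |x - S| := abs_sub_le _ _ _
        have a6 : η * |ρ x τ - S| ≤ η * (2 * π * (ε * M) + δ') :=
          mul_le_mul_of_nonneg_left (by linarith) hη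
        have a7 : |k τ * (ρ x τ - x)| ≤ N * (2 * π * (ε * M)) := by
          rw [abs_mul]
          exact mul_le_mul (hN τ) a3 (abs_nonneg _) hN0
        rw [Real.norm_eq_abs]
        have a8 : h (ρ x τ) τ - g τ - k τ * (x - S) =
          (h (ρ x τ) τ - h S τ - k τ * (ρ x τ - S)) + (h S τ - g τ) + k τ * (ρ x τ - x) := by ring
        rw [a8]
        refine (abs_add_three _ _ _).trans ?_
        rw [hC]; linarith)
    rw [Real.norm_eq_abs, sub_zero, abs_of_pos hpi] at this
    linarith
  have hlam : 0 < |lam| := by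
    have := abs_nonneg (h S 0 - g 0)
    have hκ : 0 ≤ κ := this.trans (hgκ 0)
    have hC0 : 0 ≤ 2 * π * C := by positivity
    by_contra hcon
    nlinarith
  have hend : ∀ x ∈ closedBall S δ', ρ x (2 * π) - x = ε * ∫ τ in (0:ℝ)..(2 * π), h (ρ x τ) τ := by
    intro x hx
    rw [(hρ x hx).2.2 _ ⟨hpi.le, le_rfl⟩, add_sub_cancel_left,
      intervalIntegral.integral_const_mul]
  have hxp : S + δ' ∈ closedBall S δ' := by
    rw [mem_closedBall, Real.dist_eq, add_sub_cancel_left, abs_of_pos hδ']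
  have hxm : S - δ' ∈ closedBall S δ' := by
    rw [mem_closedBall, Real.dist_eq, sub_sub_cancel_left, abs_neg, abs_of_pos hδ']
  have hll : lam * lam = |lam| * |lam| := (abs_mul_abs_self lam).symm
  have hpos : 0 ≤ lam * (ρ (S + δ') (2 * π) - (S + δ')) := by
    rw [hend _ hxp]
    have h3 := hmain _ hxp
    rw [add_sub_cancel_left] at h3
    set Q := ∫ τ in (0:ℝ)..(2 * π), h (ρ (S + δ') τ) τ
    have h4 : |lam * (Q - lam * δ')| ≤ |lam| * (|lam| * δ') := by
      rw [abs_mul]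
      exact mul_le_mul_of_nonneg_left (h3.trans h2.le) hlam.le
    have h5 := (abs_le.1 h4).1
    have h6 : 0 ≤ lam * Q := by nlinarith
    calc 0 ≤ ε * (lam * Q) := by positivity
      _ = _ := by ring
  have hneg : lam * (ρ (S - δ') (2 * π) - (S - δ')) ≤ 0 := by
    rw [hend _ hxm]
    have h3 := hmain _ hxm
    rw [sub_sub_cancel_left] at h3
    set Q := ∫ τ in (0:ℝ)..(2 * π), h (ρ (S - δ') τ) τ
    have h4 : |lam * (Q - lam * -δ')| ≤ |lam| * (|lam| * δ') := by
      rw [abs_mul]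
      exact mul_le_mul_of_nonneg_left (h3.trans h2.le) hlam.le
    have h5 := (abs_le.1 h4).2
    have h6 : 0 ≤ -(lam * Q) := by nlinarith
    have : 0 ≤ ε * (-(lam * Q)) := by positivity
    nlinarith
  have hball : closedBall S δ' = Icc (S - δ') (S + δ') := Real.closedBall_eq_Icc
  have hcon : ContinuousOn (fun x => lam * (ρ x (2 * π) - x)) (Icc (S - δ') (S + δ')) := by
    rw [← hball]
    exact continuousOn_const.mul ((hρc _ ⟨hpi.le, le_rfl⟩).sub continuousOn_id)
  obtain ⟨x, hx, hx0⟩ := intermediate_value_Icc (by linarith) hcon ⟨hneg, hpos⟩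
  rw [← hball] at hx
  have hlne : lam ≠ 0 := abs_pos.1 hlam
  have hclose : ρ x (2 * π) = x := by
    rcases mul_eq_zero.1 hx0 with h3 | h3
    · exact absurd h3 hlne
    · linarith
  obtain ⟨σ, hσ1, hσ2, hσ3⟩ := aux_extend h S δ ε x (ρ x) hper hcont (hρ x hx).1 (hρ x hx).2.1
    (hρ x hx).2.2 hclose
  refine ⟨σ, hσ1, hσ2, fun θ => ?_⟩
  obtain ⟨t, ht, he⟩ := hσ3 θ
  rw [he]
  have a3 := hdist x hx t ht
  have a4 : |x - S| ≤ δ' := by rw [← Real.dist_eq]; exact hx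
  have a5 : |ρ x t - S| ≤ |ρ x t - x| + |x - S| := abs_sub_le _ _ _
  linarith

/-- Monotonicity of the weighted square of the difference. -/
lemma aux_unique_neg (k : ℝ → ℝ) (hk : Continuous k) (hkper : Function.Periodic k (2 * π))
    (lam : ℝ) (hlam : ∫ θ in (0:ℝ)..(2 * π), k θ = lam) (sgn : ℝ) (hneg : sgn * lam < 0)
    (D D' th w : ℝ → ℝ) (ε : ℝ) (hε : 0 < ε)
    (hD : ∀ t, HasDerivAt D (D' t) t) (hth : ∀ t, HasDerivAt th (w t) t)
    (hest : ∀ t, sgn * (D t * D' t) ≤ sgn * (ε * w t * k (th t) * (D t) ^ 2))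
    (T : ℝ) (hT : 0 < T) (hDT : ∀ t, D (t + T) = D t) (n : ℤ) (hn : 0 < n)
    (hthT : ∀ t, th (t + T) = th t + n * (2 * π)) : ∀ t, D t = 0 := by
  let K : ℝ → ℝ := fun θ => ∫ τ in (0:ℝ)..θ, k τ
  have hK : ∀ θ, HasDerivAt K (k θ) θ := fun θ => (hk.integral_hasStrictDerivAt 0 θ).hasDerivAt
  have hKT : ∀ θ, K (θ + n * (2 * π)) = K θ + n * lam := by
    intro θ
    have : K (θ + n * (2 * π)) - K θ = n * lam := by
      simp only [K]
      rw [intervalIntegral.integral_interval_sub_left (hk.intervalIntegrable _ _)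
        (hk.intervalIntegrable _ _)]
      have := hkper.intervalIntegral_add_zsmul_eq n θ (fun t1 t2 => hk.intervalIntegrable _ _)
      simp only [zsmul_eq_mul] at this
      rw [this]
      rw [hkper.intervalIntegral_add_eq θ 0, zero_add, hlam]
    linarith
  let E : ℝ → ℝ := fun t => sgn * ((D t) ^ 2 * exp (-(2 * ε * K (th t))))
  have hE : ∀ t, HasDerivAt E
      (sgn * ((2 * (D t) * D' t) * exp (-(2 * ε * K (th t))) +
        (D t) ^ 2 * (exp (-(2 * ε * K (th t))) * -(2 * ε * (k (th t) * w t))))) t := by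
    intro t
    have a1 : HasDerivAt (fun t => (D t) ^ 2) (2 * (D t) * D' t) t := by
      simpa using (hD t).fun_pow 2
    have a2 : HasDerivAt (fun t => K (th t)) (k (th t) * w t) t := (hK (th t)).comp t (hth t)
    exact (a1.mul ((a2.const_mul (2 * ε)).neg.exp)).const_mul sgn
  have hanti : Antitone E := by
    apply antitone_of_hasDerivAt_nonpos hE
    intro t
    have e := exp_pos (-(2 * ε * K (th t)))
    have : sgn * ((2 * (D t) * D' t) * exp (-(2 * ε * K (th t))) +
        (D t) ^ 2 * (exp (-(2 * ε * K (th t))) * -(2 * ε * (k (th t) * w t)))) =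
        2 * exp (-(2 * ε * K (th t))) * (sgn * (D t * D' t) -
          sgn * (ε * w t * k (th t) * (D t) ^ 2)) := by ring
    refine this.le.trans ?_
    apply mul_nonpos_of_nonneg_of_nonpos (by positivity)
    linarith [hest t]
  intro t
  by_contra hDt
  have h1 := hanti (by linarith : t ≤ t + T)
  simp only [E] at h1
  rw [hDT, hthT, hKT, show -(2 * ε * (K (th t) + n * lam)) =
    -(2 * ε * K (th t)) + -(2 * ε * (n * lam)) by ring, exp_add] at h1
  have hp : 0 < (D t) ^ 2 * exp (-(2 * ε * K (th t))) := by positivity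
  set P := (D t) ^ 2 * exp (-(2 * ε * K (th t)))
  have h2 : P * (sgn * (exp (-(2 * ε * (n * lam))) - 1)) ≤ 0 := by
    rw [← mul_assoc (D t ^ 2)] at h1
    nlinarith
  have h3 : sgn * (exp (-(2 * ε * (n * lam))) - 1) ≤ 0 := by
    by_contra hc
    push Not at hc
    nlinarith [mul_pos hp hc]
  have hn' : (0:ℝ) < n := by exact_mod_cast hn
  rcases lt_trichotomy lam 0 with hl | hl | hl
  · have hs : 0 < sgn := by nlinarith
    have : 1 < exp (-(2 * ε * (n * lam))) := by
      rw [one_lt_exp_iff]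
      have : 0 < 2 * ε * (n * -lam) := by
        have : 0 < -lam := by linarith
        positivity
      linarith
    nlinarith
  · simp [hl] at hneg
  · have hs : sgn < 0 := by nlinarith
    have : exp (-(2 * ε * (n * lam))) < 1 := by
      rw [exp_lt_one_iff]
      have : 0 < 2 * ε * (n * lam) := by positivity
      linarith
    nlinarith
lemma aux_surj (f : ℝ → ℝ) (hf : Continuous f) (p q : ℝ) (hq : 0 < q)
    (h : ∀ x, f (x + p) = f x + q) : Function.Surjective f := by
  have h1 : ∀ n : ℕ, f (n * p) = f 0 + n * q := by
    intro n
    induction n with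
    | zero => simp
    | succ n ih =>
      push_cast
      rw [add_mul, one_mul, h, ih]; ring
  have h2 : ∀ n : ℕ, f (-(n * p)) = f 0 - n * q := by
    intro n
    induction n with
    | zero => simp
    | succ n ih =>
      push_cast
      have := h (-((n + 1) * p))
      rw [show -(((n:ℝ) + 1) * p) + p = -(n * p) by ring, ih] at this
      linarith
  intro y
  obtain ⟨n, hn⟩ := exists_nat_gt ((y - f 0) / q)
  obtain ⟨m, hm⟩ := exists_nat_gt ((f 0 - y) / q)
  rw [div_lt_iff₀ hq] at hn hm
  exact mem_range_of_exists_le_of_exists_ge hf ⟨_, by rw [h2 m]; linarith⟩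
    ⟨_, by rw [h1 n]; linarith⟩

lemma aux_polar (x y s th u v : ℝ → ℝ)
    (hx : ∀ t, HasDerivAt x (u t * x t - v t * y t) t)
    (hy : ∀ t, HasDerivAt y (u t * y t + v t * x t) t)
    (hs : ∀ t, HasDerivAt s (u t) t) (hth : ∀ t, HasDerivAt th (v t) t)
    (hx0 : x 0 = exp (s 0) * cos (th 0)) (hy0 : y 0 = exp (s 0) * sin (th 0)) (t : ℝ) :
    x t = exp (s t) * cos (th t) ∧ y t = exp (s t) * sin (th t) := by
  let P : ℝ → ℝ := fun t => exp (-s t) * (x t * cos (th t) + y t * sin (th t))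
  let Q : ℝ → ℝ := fun t => exp (-s t) * (y t * cos (th t) - x t * sin (th t))
  have hP : ∀ t, HasDerivAt P 0 t := by
    intro t
    have h := ((hs t).fun_neg.exp).fun_mul
      (((hx t).fun_mul (hth t).cos).fun_add ((hy t).fun_mul (hth t).sin))
    convert! h using 1
    ring
  have hQ : ∀ t, HasDerivAt Q 0 t := by
    intro t
    have h := ((hs t).fun_neg.exp).fun_mul
      (((hy t).fun_mul (hth t).cos).fun_sub ((hx t).fun_mul (hth t).sin))
    convert! h using 1
    ring
  have hPc : P t = P 0 := is_const_of_deriv_eq_zero (fun t => (hP t).differentiableAt)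
    (fun t => (hP t).deriv) t 0
  have hQc : Q t = Q 0 := is_const_of_deriv_eq_zero (fun t => (hQ t).differentiableAt)
    (fun t => (hQ t).deriv) t 0
  have hP0 : P 0 = 1 := by
    simp only [P, hx0, hy0]
    rw [show exp (s 0) * cos (th 0) * cos (th 0) + exp (s 0) * sin (th 0) * sin (th 0) =
      exp (s 0) * (sin (th 0) ^ 2 + cos (th 0) ^ 2) by ring, sin_sq_add_cos_sq, mul_one, ← exp_add]
    simp
  have hQ0 : Q 0 = 0 := by
    simp only [Q, hx0, hy0]; ring
  rw [hP0] at hPc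
  rw [hQ0] at hQc
  have hee : exp (s t) * exp (-s t) = 1 := by rw [← exp_add]; simp
  have hsc := sin_sq_add_cos_sq (th t)
  simp only [P] at hPc
  simp only [Q] at hQc
  constructor
  · calc x t = (exp (s t) * exp (-s t)) * (sin (th t) ^ 2 + cos (th t) ^ 2) * x t := by
          rw [hee, hsc]; ring
      _ = exp (s t) * ((exp (-s t) * (x t * cos (th t) + y t * sin (th t))) * cos (th t) -
          (exp (-s t) * (y t * cos (th t) - x t * sin (th t))) * sin (th t)) := by ring
      _ = _ := by rw [hPc, hQc]; ring
  · calc y t = (exp (s t) * exp (-s t)) * (sin (th t) ^ 2 + cos (th t) ^ 2) * y t := by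
          rw [hee, hsc]; ring
      _ = exp (s t) * ((exp (-s t) * (x t * cos (th t) + y t * sin (th t))) * sin (th t) +
          (exp (-s t) * (y t * cos (th t) - x t * sin (th t))) * cos (th t)) := by ring
      _ = _ := by rw [hPc, hQc]; ring

lemma aux_sq (s θ : ℝ) : (exp s * cos θ) ^ 2 + (exp s * sin θ) ^ 2 = exp (2 * s) := by
  rw [show (exp s * cos θ) ^ 2 + (exp s * sin θ) ^ 2 =
      (exp s * exp s) * (sin θ ^ 2 + cos θ ^ 2) by ring, sin_sq_add_cos_sq, mul_one, ← exp_add]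
  ring_nf

lemma aux_lift (Y : ℝ × ℝ → ℝ × ℝ) (hYc : Continuous Y) (a w : ℝ → ℝ → ℝ)
    (hY : ∀ s θ, Y (exp s * cos θ, exp s * sin θ) =
      (exp s * (a s θ * cos θ - w s θ * sin θ), exp s * (a s θ * sin θ + w s θ * cos θ)))
    (ψ : ℝ → ℝ × ℝ) (hψ : IsSolution Y ψ) (hne : ∀ t, 0 < (ψ t).1 ^ 2 + (ψ t).2 ^ 2) :
    ∃ (s th : ℝ → ℝ) (Ω : ℝ × ℝ → ℝ), (∀ t, ψ t = (exp (s t) * cos (th t), exp (s t) * sin (th t))) ∧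
      (∀ t, s t = log ((ψ t).1 ^ 2 + (ψ t).2 ^ 2) / 2) ∧
      (∀ t, HasDerivAt s (a (s t) (th t)) t) ∧ (∀ t, HasDerivAt th (w (s t) (th t)) t) ∧
      (∀ t, HasDerivAt th (Ω (ψ t)) t) := by
  have hψc : Continuous ψ := continuous_iff_continuousAt.2 fun t => (hψ t).continuousAt
  let x : ℝ → ℝ := fun t => (ψ t).1
  let y : ℝ → ℝ := fun t => (ψ t).2
  have hx : ∀ t, HasDerivAt x (Y (ψ t)).1 t := fun t => by
    simpa using (hψ t).hasFDerivAt.fst.hasDerivAt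
  have hy : ∀ t, HasDerivAt y (Y (ψ t)).2 t := fun t => by
    simpa using (hψ t).hasFDerivAt.snd.hasDerivAt
  have hne' : ∀ t, 0 < x t ^ 2 + y t ^ 2 := hne
  let Ω : ℝ × ℝ → ℝ := fun p => (p.1 * (Y p).2 - p.2 * (Y p).1) / (p.1 ^ 2 + p.2 ^ 2)
  let v : ℝ → ℝ := fun t => Ω (ψ t)
  let u : ℝ → ℝ := fun t => (x t * (Y (ψ t)).1 + y t * (Y (ψ t)).2) / (x t ^ 2 + y t ^ 2)
  have hvc : Continuous v := by
    apply Continuous.div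
    · fun_prop
    · fun_prop
    · exact fun t => (hne t).ne'
  obtain ⟨θ0, hθ1, hθ2⟩ : ∃ θ0, x 0 = exp (log (x 0 ^ 2 + y 0 ^ 2) / 2) * cos θ0 ∧
      y 0 = exp (log (x 0 ^ 2 + y 0 ^ 2) / 2) * sin θ0 := by
    let z : ℂ := ⟨x 0, y 0⟩
    have hz : exp (log (x 0 ^ 2 + y 0 ^ 2) / 2) = ‖z‖ := by
      rw [Complex.norm_def, Complex.normSq_apply, ← Real.log_sqrt (hne' 0).le,
        exp_log (Real.sqrt_pos.2 (hne' 0))]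
      simp only [z]; ring_nf
    refine ⟨Complex.arg z, ?_, ?_⟩
    · rw [hz, Complex.norm_mul_cos_arg]
    · rw [hz, Complex.norm_mul_sin_arg]
  let th : ℝ → ℝ := fun t => θ0 + ∫ τ in (0:ℝ)..t, v τ
  have hth : ∀ t, HasDerivAt th (v t) t := fun t =>
    (hvc.integral_hasStrictDerivAt 0 t).hasDerivAt.const_add θ0
  let s : ℝ → ℝ := fun t => log (x t ^ 2 + y t ^ 2) / 2
  have hs : ∀ t, HasDerivAt s (u t) t := by
    intro t
    have h := ((((hx t).fun_pow 2).fun_add ((hy t).fun_pow 2)).log (hne' t).ne').div_const 2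
    convert! h using 1
    simp only [u]
    have := (hne' t).ne'
    field_simp
    simp
    ring
  have hx' : ∀ t, HasDerivAt x (u t * x t - v t * y t) t := by
    intro t
    convert hx t using 1
    have := (hne' t).ne'
    simp only [u, v, Ω]
    change _ - (x t * (Y (ψ t)).2 - y t * (Y (ψ t)).1) / (x t ^ 2 + y t ^ 2) * y t = _
    field_simp
    ring
  have hy' : ∀ t, HasDerivAt y (u t * y t + v t * x t) t := by
    intro t
    convert hy t using 1
    have := (hne' t).ne'
    simp only [u, v, Ω]
    change _ + (x t * (Y (ψ t)).2 - y t * (Y (ψ t)).1) / (x t ^ 2 + y t ^ 2) * x t = _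
    field_simp
    ring
  have hth0 : th 0 = θ0 := by simp [th]
  have hpol := aux_polar x y s th u v hx' hy' hs hth (by rw [hth0]; exact hθ1)
    (by rw [hth0]; exact hθ2)
  have hψp : ∀ t, ψ t = (exp (s t) * cos (th t), exp (s t) * sin (th t)) :=
    fun t => Prod.ext (hpol t).1 (hpol t).2
  have hu : ∀ t, u t = a (s t) (th t) := by
    intro t
    simp only [u]
    rw [hψp t, hY, (hpol t).1, (hpol t).2, aux_sq, div_eq_iff (exp_pos _).ne']
    have : exp (2 * s t) = exp (s t) * exp (s t) := by rw [← exp_add]; ring_nf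
    simp only
    rw [this]
    linear_combination (exp (s t) * exp (s t) * a (s t) (th t)) * sin_sq_add_cos_sq (th t)
  have hv : ∀ t, v t = w (s t) (th t) := by
    intro t
    simp only [v, Ω]
    rw [hψp t, hY, aux_sq, div_eq_iff (exp_pos _).ne']
    have : exp (2 * s t) = exp (s t) * exp (s t) := by rw [← exp_add]; ring_nf
    simp only
    rw [this]
    linear_combination (exp (s t) * exp (s t) * w (s t) (th t)) * sin_sq_add_cos_sq (th t)
  refine ⟨s, th, Ω, hψp, fun t => rfl, ?_, ?_, hth⟩
  · intro t; rw [← hu]; exact hs t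
  · intro t; rw [← hv]; exact hth t

lemma aux_cycle (Y : ℝ × ℝ → ℝ × ℝ) (hYc : Continuous Y) (a w : ℝ → ℝ → ℝ)
    (hwc : Continuous (fun p : ℝ × ℝ => w p.1 p.2))
    (hwp : ∀ s θ, w s (θ + 2 * π) = w s θ)
    (hY : ∀ s θ, Y (exp s * cos θ, exp s * sin θ) =
      (exp s * (a s θ * cos θ - w s θ * sin θ), exp s * (a s θ * sin θ + w s θ * cos θ)))
    (S δ : ℝ) (hw : ∀ s, |s - S| < δ → ∀ θ, 0 < w s θ)
    (σ : ℝ → ℝ) (hσp : ∀ θ, σ (θ + 2 * π) = σ θ)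
    (hσd : ∀ θ, HasDerivAt σ (a (σ θ) θ / w (σ θ) θ) θ) (hσS : ∀ θ, |σ θ - S| < δ)
    (huniq : ∀ (s th : ℝ → ℝ), (∀ t, HasDerivAt s (a (s t) (th t)) t) →
      (∀ t, HasDerivAt th (w (s t) (th t)) t) → (∀ t, |s t - S| < δ) →
      ∀ T > 0, (∀ t, s (t + T) = s t) → ∀ n : ℤ, 0 < n →
      (∀ t, th (t + T) = th t + n * (2 * π)) → ∀ t, s t = σ (th t)) :
    ∃ φ, IsLimitCycle Y φ ∧ ∀ t, ∃ s θ, |s - S| < δ ∧ φ t = (exp s * cos θ, exp s * sin θ) := by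
  have hpi : 0 < 2 * π := by positivity
  have hσc : Continuous σ := continuous_iff_continuousAt.2 fun t => (hσd t).continuousAt
  have hW : ∀ θ, 0 < w (σ θ) θ := fun θ => hw _ (hσS θ) θ
  let g : ℝ → ℝ := fun θ => (w (σ θ) θ)⁻¹
  have hWc : Continuous (fun θ => w (σ θ) θ) :=
    hwc.comp (f := fun θ => (σ θ, θ)) (by fun_prop)
  have hgc : Continuous g := hWc.inv₀ fun θ => (hW θ).ne'
  have hgp : Function.Periodic g (2 * π) := fun θ => by simp only [g, hσp, hwp]
  let τ : ℝ → ℝ := fun θ => ∫ y in (0:ℝ)..θ, g y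
  have hτd : ∀ θ, HasDerivAt τ (g θ) θ := fun θ => (hgc.integral_hasStrictDerivAt 0 θ).hasDerivAt
  have hτc : Continuous τ := continuous_iff_continuousAt.2 fun t => (hτd t).continuousAt
  have hτm : StrictMono τ := strictMono_of_hasDerivAt_pos hτd (fun θ => inv_pos.2 (hW θ))
  let T0 := τ (2 * π)
  have hT0 : 0 < T0 := by
    have := hτm hpi
    simpa [τ] using this
  have hτp : ∀ θ, τ (θ + 2 * π) = τ θ + T0 := by
    intro θ
    simp only [τ, T0]
    rw [← intervalIntegral.integral_add_adjacent_intervals (hgc.intervalIntegrable 0 θ)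
      (hgc.intervalIntegrable θ (θ + 2 * π)), hgp.intervalIntegral_add_eq θ 0, zero_add]
  have hτs := aux_surj τ hτc _ _ hT0 hτp
  let e := hτm.orderIsoOfSurjective τ hτs
  let Θ : ℝ → ℝ := e.symm
  have hΘτ : ∀ θ, Θ (τ θ) = θ := fun θ => e.symm_apply_apply θ
  have hτΘ : ∀ t, τ (Θ t) = t := fun t => e.apply_symm_apply t
  have hΘc : Continuous Θ := e.symm.continuous
  have hΘd : ∀ t, HasDerivAt Θ (w (σ (Θ t)) (Θ t)) t := by
    intro t
    have := HasDerivAt.of_local_left_inverse hΘc.continuousAt (hτd (Θ t))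
      (inv_pos.2 (hW _)).ne' (Eventually.of_forall hτΘ)
    simpa [g] using this
  have hΘp : ∀ t, Θ (t + T0) = Θ t + 2 * π := by
    intro t
    rw [← hΘτ (Θ t + 2 * π), hτp, hτΘ]
  let φ : ℝ → ℝ × ℝ := fun t => (exp (σ (Θ t)) * cos (Θ t), exp (σ (Θ t)) * sin (Θ t))
  have hφ : IsSolution Y φ := by
    intro t
    have h1 : HasDerivAt (fun t => σ (Θ t)) (a (σ (Θ t)) (Θ t)) t := by
      have := (hσd (Θ t)).comp t (hΘd t)
      rw [div_mul_cancel₀ _ (hW _).ne'] at this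
      exact this
    have h2 := (h1.exp.fun_mul (hΘd t).cos).prodMk (h1.exp.fun_mul (hΘd t).sin)
    show HasDerivAt φ (Y (exp (σ (Θ t)) * cos (Θ t), exp (σ (Θ t)) * sin (Θ t))) t
    rw [hY]
    convert! h2 using 1
    ext <;> simp <;> ring
  have hφper : IsPeriodicOrbit Y φ := by
    refine ⟨hφ, ⟨T0, hT0, ?_⟩, ?_⟩
    · intro t
      simp only [φ, hΘp, hσp, cos_add_two_pi, sin_add_two_pi]
    · rintro ⟨c, hc⟩
      have h1 := congrArg Prod.fst ((hc (τ 0)).trans (hc (τ π)).symm)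
      simp only [φ, hΘτ, cos_zero, cos_pi] at h1
      linarith [exp_pos (σ 0), exp_pos (σ π)]
  refine ⟨φ, ⟨hφper, {p | exp (2 * (S - δ)) < p.1 ^ 2 + p.2 ^ 2 ∧
      p.1 ^ 2 + p.2 ^ 2 < exp (2 * (S + δ))}, ?_, ?_, ?_⟩, fun t => ⟨_, _, hσS _, rfl⟩⟩
  · refine IsOpen.and ?_ ?_
    · exact isOpen_lt (by fun_prop) (by fun_prop)
    · exact isOpen_lt (by fun_prop) (by fun_prop)
  · rintro _ ⟨t, rfl⟩
    simp only [φ, mem_ofPred_eq, aux_sq, exp_lt_exp]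
    have := abs_lt.1 (hσS (Θ t))
    constructor <;> linarith [this.1, this.2]
  · rintro ψ ⟨hψ, ⟨T, hT, hψT⟩, -⟩ hψU
    have hU : ∀ t, exp (2 * (S - δ)) < (ψ t).1 ^ 2 + (ψ t).2 ^ 2 ∧
      (ψ t).1 ^ 2 + (ψ t).2 ^ 2 < exp (2 * (S + δ)) := fun t => hψU ⟨t, rfl⟩
    have hne : ∀ t, 0 < (ψ t).1 ^ 2 + (ψ t).2 ^ 2 := fun t => (exp_pos _).trans (hU t).1
    obtain ⟨s, th, Ω, hpol, hs, hsd, hthd, hthΩ⟩ := aux_lift Y hYc a w hY ψ hψ hne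
    have hsS : ∀ t, |s t - S| < δ := by
      intro t
      rw [hs t, abs_lt]
      have h1 := (lt_log_iff_exp_lt (hne t)).2 (hU t).1
      have h2 := (log_lt_iff_lt_exp (hne t)).2 (hU t).2
      constructor <;> linarith
    have hsT : ∀ t, s (t + T) = s t := fun t => by rw [hs, hs, hψT]
    have hthm : StrictMono th := strictMono_of_hasDerivAt_pos hthd (fun t => hw _ (hsS t) _)
    have hthc : Continuous th := continuous_iff_continuousAt.2 fun t => (hthd t).continuousAt
    have hdd : ∀ t, HasDerivAt (fun t => th (t + T) - th t) 0 t := by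
      intro t
      have h1 : HasDerivAt (fun t => th (t + T)) (Ω (ψ t)) t := by
        have := hthΩ (t + T)
        rw [hψT] at this
        exact this.comp_add_const t T
      simpa using h1.fun_sub (hthΩ t)
    have hconst : ∀ t, th (t + T) - th t = th (0 + T) - th 0 := fun t =>
      is_const_of_deriv_eq_zero (fun t => (hdd t).differentiableAt) (fun t => (hdd t).deriv) t 0
    obtain ⟨n, hn⟩ : ∃ n : ℤ, th (0 + T) - th 0 = 2 * π * n := by
      apply Real.Angle.angle_eq_iff_two_pi_dvd_sub.1
      have h1 := hψT 0
      rw [hpol, hpol, hsT] at h1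
      have h2 := mul_left_cancel₀ (exp_pos _).ne' (congrArg Prod.fst h1)
      have h3 := mul_left_cancel₀ (exp_pos _).ne' (congrArg Prod.snd h1)
      exact Real.Angle.cos_sin_inj h2 h3
    have hnpos : 0 < n := by
      have h1 : 0 < 2 * π * (n : ℝ) := by
        rw [← hn]; have := hthm (by linarith : (0:ℝ) < 0 + T); linarith
      have h2 := pos_of_mul_pos_right h1 hpi.le
      exact_mod_cast h2
    have hthT : ∀ t, th (t + T) = th t + n * (2 * π) := by
      intro t
      have := hconst t
      rw [hn] at this
      linarith
    have hu := huniq s th hsd hthd hsS T hT hsT n hnpos hthT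
    have hths : Function.Surjective th := aux_surj th hthc T (n * (2 * π))
      (by have : (0:ℝ) < n := by exact_mod_cast hnpos
          positivity) hthT
    apply Set.Subset.antisymm
    · rintro _ ⟨t, rfl⟩
      refine ⟨τ (th t), ?_⟩
      simp only [φ, hΘτ]
      rw [hpol t, hu t]
    · rintro _ ⟨t, rfl⟩
      obtain ⟨r, hr⟩ := hths (Θ t)
      refine ⟨r, ?_⟩
      rw [hpol r, hu r, hr]

lemma aux_tube (Ψ : ℝ × ℝ → ℝ → ℝ) (S : ℝ)
    (hc : ∀ θ, ContinuousAt (fun q : (ℝ × ℝ) × ℝ => Ψ q.1 q.2) ((0, S), θ))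
    (h0 : ∀ θ, Ψ (0, S) θ = 0) (hp : ∀ z θ, Ψ z (θ + 2 * π) = Ψ z θ) (η : ℝ) (hη : 0 < η) :
    ∀ᶠ z in 𝓝 ((0, S) : ℝ × ℝ), ∀ θ, |Ψ z θ| < η := by
  have hpi : 0 < 2 * π := by positivity
  have h1 : ∀ᶠ z in 𝓝 ((0, S) : ℝ × ℝ), ∀ θ ∈ Icc 0 (2 * π), |Ψ z θ| < η := by
    apply isCompact_Icc.eventually_forall_of_forall_eventually
    intro θ _
    have h2 : ContinuousAt (fun q : (ℝ × ℝ) × ℝ => |Ψ q.1 q.2|) ((0, S), θ) := (hc θ).abs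
    apply h2.eventually_lt_const
    simpa [h0] using hη
  filter_upwards [h1] with z hz θ
  have hper : Function.Periodic (Ψ z) (2 * π) := hp z
  obtain ⟨t, ht, he⟩ := hper.exists_mem_Ico₀ hpi θ
  rw [he]
  exact hz t ⟨ht.1, ht.2.le⟩

lemma aux_bdd (f : ℝ → ℝ) (hf : Continuous f) (hp : ∀ θ, f (θ + 2 * π) = f θ) :
    ∃ N, ∀ θ, |f θ| ≤ N := by
  have hpi : 0 < 2 * π := by positivity
  obtain ⟨N, hN⟩ := isCompact_Icc.exists_bound_of_continuousOn (s := Icc 0 (2 * π)) hf.continuousOn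
  refine ⟨N, fun θ => ?_⟩
  have hper : Function.Periodic f (2 * π) := hp
  obtain ⟨t, ht, he⟩ := hper.exists_mem_Ico₀ hpi θ
  rw [he]
  exact hN t ⟨ht.1, ht.2.le⟩

lemma aux_root (A B A' B' : ℝ → ℝ → ℝ) (Y : ℝ → ℝ × ℝ → ℝ × ℝ)
    (hYc : ∀ ε, Continuous (Y ε))
    (hY : ∀ ε s θ, Y ε (exp s * cos θ, exp s * sin θ) =
      (exp s * ((ε * A s θ) * cos θ - (1 + ε * B s θ) * sin θ),
        exp s * ((ε * A s θ) * sin θ + (1 + ε * B s θ) * cos θ)))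
    (hA : Continuous (fun p : ℝ × ℝ => A p.1 p.2)) (hB : Continuous (fun p : ℝ × ℝ => B p.1 p.2))
    (hA' : Continuous (fun p : ℝ × ℝ => A' p.1 p.2))
    (hB' : Continuous (fun p : ℝ × ℝ => B' p.1 p.2))
    (hAp : ∀ s θ, A s (θ + 2 * π) = A s θ) (hBp : ∀ s θ, B s (θ + 2 * π) = B s θ)
    (hAp' : ∀ s θ, A' s (θ + 2 * π) = A' s θ) (hBp' : ∀ s θ, B' s (θ + 2 * π) = B' s θ)
    (hAd : ∀ s θ, HasDerivAt (fun s => A s θ) (A' s θ) s)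
    (hBd : ∀ s θ, HasDerivAt (fun s => B s θ) (B' s θ) s)
    (S d : ℝ) (hd : 0 < d) (h0 : ∫ θ in (0:ℝ)..(2 * π), A S θ = 0)
    (h1 : ∫ θ in (0:ℝ)..(2 * π), A' S θ ≠ 0) :
    ∀ᶠ ε in 𝓝[>] (0:ℝ), ∃ φ, IsLimitCycle (Y ε) φ ∧
      ∀ t, ∃ s θ, |s - S| < d ∧ φ t = (exp s * cos θ, exp s * sin θ) := by
  have hpi : 0 < 2 * π := by positivity
  set lam := ∫ θ in (0:ℝ)..(2 * π), A' S θ with hlam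
  have hlpos : 0 < |lam| := abs_pos.2 h1
  set η := |lam| / (4 * π) with hη
  have hηpos : 0 < η := by positivity
  have hη2 : 2 * π * η = |lam| / 2 := by rw [hη]; field_simp; ring
  have cA : Continuous (fun q : (ℝ × ℝ) × ℝ => A q.1.2 q.2) :=
    hA.comp (f := fun q : (ℝ × ℝ) × ℝ => (q.1.2, q.2)) (by fun_prop)
  have cB : Continuous (fun q : (ℝ × ℝ) × ℝ => B q.1.2 q.2) :=
    hB.comp (f := fun q : (ℝ × ℝ) × ℝ => (q.1.2, q.2)) (by fun_prop)
  have cA' : Continuous (fun q : (ℝ × ℝ) × ℝ => A' q.1.2 q.2) :=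
    hA'.comp (f := fun q : (ℝ × ℝ) × ℝ => (q.1.2, q.2)) (by fun_prop)
  have cB' : Continuous (fun q : (ℝ × ℝ) × ℝ => B' q.1.2 q.2) :=
    hB'.comp (f := fun q : (ℝ × ℝ) × ℝ => (q.1.2, q.2)) (by fun_prop)
  have cAS : Continuous (fun θ => A S θ) := hA.comp (f := fun θ => (S, θ)) (by fun_prop)
  have cAS' : Continuous (fun θ => A' S θ) := hA'.comp (f := fun θ => (S, θ)) (by fun_prop)
  have cASq : Continuous (fun q : (ℝ × ℝ) × ℝ => A S q.2) := cAS.comp continuous_snd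
  have cASq' : Continuous (fun q : (ℝ × ℝ) × ℝ => A' S q.2) := cAS'.comp continuous_snd
  have cden : Continuous (fun q : (ℝ × ℝ) × ℝ => 1 + q.1.1 * B q.1.2 q.2) := by fun_prop
  have e1 := aux_tube (fun z θ => z.1 * B z.2 θ) S
    (fun θ => by apply Continuous.continuousAt; fun_prop) (fun θ => by simp)
    (fun z θ => by simp only [hBp]) (1 / 2) (by norm_num)
  have e2 := aux_tube (fun z θ => (A' z.2 θ * (1 + z.1 * B z.2 θ) - A z.2 θ * (z.1 * B' z.2 θ)) /
      (1 + z.1 * B z.2 θ) ^ 2 - A' S θ) S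
    (fun θ => by
      apply ContinuousAt.sub _ cASq'.continuousAt
      apply ContinuousAt.div
      · apply Continuous.continuousAt; fun_prop
      · apply Continuous.continuousAt; fun_prop
      · simp) (fun θ => by simp)
    (fun z θ => by simp only [hBp, hAp, hAp', hBp']) η hηpos
  have e3 : ∀ κ : ℝ, 0 < κ → ∀ᶠ z in 𝓝 ((0, S) : ℝ × ℝ), ∀ θ,
      |A z.2 θ / (1 + z.1 * B z.2 θ) - A S θ| < κ := fun κ hκ =>
    aux_tube (fun z θ => A z.2 θ / (1 + z.1 * B z.2 θ) - A S θ) S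
    (fun θ => by
      apply ContinuousAt.sub _ cASq.continuousAt
      apply ContinuousAt.div
      · exact cA.continuousAt
      · exact cden.continuousAt
      · simp) (fun θ => by simp)
    (fun z θ => by simp only [hBp, hAp]) κ hκ
  obtain ⟨r, hr, hball⟩ := Metric.eventually_nhds_iff.1 (e1.and (e2.and (e3 1 one_pos)))
  set δ := min (r / 2) d with hδ
  have hδpos : 0 < δ := lt_min (by linarith) hd
  have hδr : δ < r := (min_le_left _ _).trans_lt (by linarith)
  have hδd : δ ≤ d := min_le_right _ _
  obtain ⟨NA, hNA⟩ := aux_bdd _ cAS (hAp S)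
  obtain ⟨N, hN⟩ := aux_bdd _ cAS' (hAp' S)
  have hNA0 : 0 ≤ NA := (abs_nonneg _).trans (hNA 0)
  set κ := |lam| * δ / (32 * π) with hκ
  have hκpos : 0 < κ := by positivity
  have hκ2 : 2 * π * κ = |lam| * δ / 16 := by rw [hκ]; field_simp; ring
  have e4 : ∀ᶠ ε in 𝓝 (0:ℝ), ∀ θ, |A S θ / (1 + ε * B S θ) - A S θ| < κ := by
    have ht : Tendsto (fun ε : ℝ => (ε, S)) (𝓝 0) (𝓝 (0, S)) := by
      apply Continuous.tendsto; fun_prop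
    exact ht.eventually (e3 κ hκpos)
  have e5 : ∀ᶠ ε in 𝓝 (0:ℝ), 2 * π * (ε * (NA + 1)) < δ - δ / 2 := by
    have hc : ContinuousAt (fun ε : ℝ => 2 * π * (ε * (NA + 1))) 0 := by fun_prop
    apply hc.eventually_lt_const
    simp; linarith
  have e6 : ∀ᶠ ε in 𝓝 (0:ℝ), 2 * π * ((η + N) * (2 * π * (ε * (NA + 1)))) < |lam| * δ / 16 := by
    have hc : ContinuousAt (fun ε : ℝ => 2 * π * ((η + N) * (2 * π * (ε * (NA + 1))))) 0 := by fun_prop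
    apply hc.eventually_lt_const
    simp; positivity
  have e7 : ∀ᶠ ε in 𝓝 (0:ℝ), |ε| < r := by
    have hc : ContinuousAt (fun ε : ℝ => |ε|) 0 := by fun_prop
    apply hc.eventually_lt_const
    simpa using hr
  filter_upwards [nhdsWithin_le_nhds e4, nhdsWithin_le_nhds e5, nhdsWithin_le_nhds e6,
    nhdsWithin_le_nhds e7, self_mem_nhdsWithin] with ε f4 f5 f6 f7 hε
  replace hε : 0 < ε := hε
  have hb : ∀ s ∈ closedBall S δ, dist ((ε, s) : ℝ × ℝ) (0, S) < r := by
    intro s hs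
    rw [Prod.dist_eq, max_lt_iff]
    exact ⟨by simpa using f7, lt_of_le_of_lt hs hδr⟩
  have hden : ∀ s ∈ closedBall S δ, ∀ θ, 0 < 1 + ε * B s θ := by
    intro s hs θ
    have := (abs_lt.1 ((hball (hb s hs)).1 θ)).1
    simp only at this
    linarith
  have hmem : ∀ s, |s - S| < δ → s ∈ closedBall S δ := fun s hs => by
    rw [mem_closedBall, Real.dist_eq]; exact hs.le
  let h : ℝ → ℝ → ℝ := fun s θ => A s θ / (1 + ε * B s θ)
  have hlip : ∀ s ∈ closedBall S δ, ∀ u ∈ closedBall S δ, ∀ θ,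
      |h s θ - h u θ - A' S θ * (s - u)| ≤ η * |s - u| := by
    intro s hs u hu θ
    have hder : ∀ y ∈ closedBall S δ, HasDerivWithinAt (fun y => h y θ - A' S θ * y)
        ((A' y θ * (1 + ε * B y θ) - A y θ * (ε * B' y θ)) / (1 + ε * B y θ) ^ 2 - A' S θ)
        (closedBall S δ) y := by
      intro y hy
      have g1 := (hAd y θ).fun_div (((hBd y θ).const_mul ε).const_add 1) (hden y hy θ).ne'
      have g2 := g1.fun_sub ((hasDerivAt_id y).const_mul (A' S θ))
      simpa using g2.hasDerivWithinAt
    have := Convex.norm_image_sub_le_of_norm_hasDerivWithin_le hder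
      (fun y hy => ((hball (hb y hy)).2.1 θ).le) (convex_closedBall S δ) hu hs
    rw [Real.norm_eq_abs, Real.norm_eq_abs] at this
    convert this using 2
    ring
  have hhcont : ContinuousOn (fun p : ℝ × ℝ => h p.1 p.2) (closedBall S δ ×ˢ univ) := by
    apply ContinuousOn.div hA.continuousOn
    · apply Continuous.continuousOn; fun_prop
    · intro p hp; exact (hden p.1 hp.1 p.2).ne'
  obtain ⟨σ, hσp, hσd, hσS⟩ := aux_exist h (A' S) (A S) S δ (δ / 2) ε (NA + 1) N η κ lam
    (fun s θ => by simp only [h, hAp, hBp]) hhcont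
    (fun s hs θ => by
      have g1 := (hball (hb s hs)).2.2 θ
      have g2 := hNA θ
      simp only at g1
      have g3 : |h s θ| ≤ |h s θ - A S θ| + |A S θ| := by
        simpa using abs_add_le (h s θ - A S θ) (A S θ)
      linarith)
    cAS' cAS hN hηpos.le hδpos (by linarith) (by linarith) hε hlip (fun θ => (f4 θ).le) h0
    hlam.symm f5 (by
      have : 0 < |lam| * δ := by positivity
      have e : 2 * π * (η * (δ / 2) + (η + N) * (2 * π * (ε * (NA + 1))) + κ) =
        (2 * π * η) * (δ / 2) + 2 * π * ((η + N) * (2 * π * (ε * (NA + 1)))) + 2 * π * κ := by ring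
      rw [e, hη2, hκ2]
      linarith)
  have hlink : ∀ s ∈ closedBall S δ, ∀ θ, ε * A s θ = ε * h s θ * (1 + ε * B s θ) := by
    intro s hs θ
    have := (hden s hs θ).ne'
    simp only [h]
    field_simp
  obtain ⟨φ, hφ, hφS⟩ := aux_cycle (Y ε) (hYc ε) (fun s θ => ε * A s θ) (fun s θ => 1 + ε * B s θ)
    (by fun_prop) (fun s θ => by simp only [hBp]) (hY ε) S δ
    (fun s hs θ => hden s (hmem s hs) θ) σ hσp
    (fun θ => by
      have := hσd θ
      simp only [h] at this
      rwa [← mul_div_assoc] at this) hσS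
    (by
      intro s th hs hth hsS T hT hsT n hn hthT
      have hσper : Function.Periodic σ (2 * π) := hσp
      have key : ∀ sgn : ℝ, (sgn = 1 ∨ sgn = -1) → sgn * lam < 0 → ∀ t, s t - σ (th t) = 0 := by
        intro sgn hsgn hneg
        have habs : |lam| = -(sgn * lam) := by
          rcases hsgn with rfl | rfl
          · rw [abs_of_neg (by linarith)]; ring
          · rw [abs_of_pos (by linarith)]; ring
        refine aux_unique_neg (fun θ => A' S θ + sgn * η) (by fun_prop)
          (fun θ => by simp only [hAp']) (lam + 2 * π * (sgn * η)) ?_ sgn ?_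
          (fun t => s t - σ (th t))
          (fun t => ε * A (s t) (th t) - ε * h (σ (th t)) (th t) * (1 + ε * B (s t) (th t)))
          th (fun t => 1 + ε * B (s t) (th t)) ε hε ?_ hth ?_ T hT ?_ n hn hthT
        · rw [intervalIntegral.integral_add (cAS'.intervalIntegrable _ _)
            (continuous_const.intervalIntegrable _ _)]
          simp [hlam]
          ring
        · have hs2 : sgn * sgn = 1 := by rcases hsgn with rfl | rfl <;> norm_num
          have : sgn * (lam + 2 * π * (sgn * η)) = sgn * lam + (sgn * sgn) * (2 * π * η) := by ring
          rw [this, hs2, hη2, habs]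
          linarith
        · intro t
          exact (hs t).fun_sub ((hσd (th t)).comp t (hth t))
        · intro t
          have m1 := hmem _ (hsS t)
          have m2 := hmem _ (hσS (th t))
          have g1 := hlip _ m1 _ m2 (th t)
          rw [hlink _ m1]
          have hw := hden _ m1 (th t)
          set D := s t - σ (th t)
          set W := 1 + ε * B (s t) (th t)
          set q := h (s t) (th t) - h (σ (th t)) (th t) with hq
          have g2 : |D * (q - A' S (th t) * D)| ≤ η * D ^ 2 := by
            rw [abs_mul]
            calc |D| * |q - A' S (th t) * D| ≤ |D| * (η * |D|) :=
                  mul_le_mul_of_nonneg_left g1 (abs_nonneg _)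
              _ = η * |D| ^ 2 := by ring
              _ = η * D ^ 2 := by rw [sq_abs]
          have g3 := abs_le.1 g2
          have g4 : sgn * (D * (q - A' S (th t) * D)) ≤ η * D ^ 2 := by
            rcases hsgn with rfl | rfl
            · linarith [g3.2]
            · linarith [g3.1]
          have hs2 : sgn * sgn = 1 := by rcases hsgn with rfl | rfl <;> norm_num
          have g5 : sgn * (ε * W * (A' S (th t) + sgn * η) * D ^ 2) - sgn * (D * (ε *
              h (s t) (th t) * W - ε * h (σ (th t)) (th t) * W)) =
              ε * W * ((sgn * sgn) * (η * D ^ 2) - sgn * (D * (q - A' S (th t) * D))) := by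
            rw [hq]; ring
          rw [hs2, one_mul] at g5
          have g6 : 0 ≤ ε * W * (η * D ^ 2 - sgn * (D * (q - A' S (th t) * D))) :=
            mul_nonneg (by positivity) (by linarith)
          linarith
        · intro t
          have := hσper.int_mul n (th t)
          simp only [hsT, hthT, this]
      intro t
      rcases lt_or_gt_of_ne h1 with hl | hl
      · linarith [key 1 (Or.inl rfl) (by linarith) t]
      · linarith [key (-1) (Or.inr rfl) (by linarith) t])
  refine ⟨φ, hφ, fun t => ?_⟩
  obtain ⟨s, θ, g1, g2⟩ := hφS t
  exact ⟨s, θ, g1.trans_le hδd, g2⟩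

/-- Theorem 1.1, first part. Consider the planar vector field
`X(x,y) = (-y,x) + ∑_{j=0}^n a_j X_j(x,y)`, where each `X_j` is a fixed continuous
homogeneous vector field of degree of homogeneity `α_j ≥ 0`, with
`α_0 < α_1 < ⋯ < α_n`. If `m + 1` is the number of indices `j` for which
`I_j = ∫_0^{2π} (f_j(cos θ, sin θ) cos θ + g_j(cos θ, sin θ) sin θ) dθ` is non-zero,
then there are values of `a` such that the system has at least `m` limit cycles. -/
theorem statement0 (n : ℕ) (X : Fin (n + 1) → ℝ × ℝ → ℝ × ℝ) (α : Fin (n + 1) → ℝ)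
    (hcont : ∀ j, Continuous (X j))
    (hαpos : ∀ j, 0 ≤ α j) (hαmono : StrictMono α)
    (hhom : ∀ j, ∀ r : ℝ, 0 ≤ r → ∀ p : ℝ × ℝ, X j (r • p) = (r ^ (α j)) • X j p)
    (I : Fin (n + 1) → ℝ)
    (hI : ∀ j, I j = ∫ θ in (0:ℝ)..(2 * π),
      ((X j (cos θ, sin θ)).1 * cos θ + (X j (cos θ, sin θ)).2 * sin θ))
    (m : ℕ) (hm : m + 1 = {j : Fin (n + 1) | I j ≠ 0}.ncard) :
    ∃ a : Fin (n + 1) → ℝ,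
      HasAtLeastNLimitCycles
        (fun p : ℝ × ℝ => ((-p.2, p.1) : ℝ × ℝ) + ∑ j, a j • X j p) m := by
  classical
  have hβ : Function.Injective (fun j => α j - 1) := by
    intro i j h
    apply hαmono.injective
    simpa using h
  have hJ : (Finset.univ.filter (fun j => I j ≠ 0)).card = m + 1 := by
    rw [hm, Set.ncard_eq_toFinset_card']
    congr 1
    ext j
    simp
  obtain ⟨c, hc⟩ := aux_simple_zeros (Finset.univ.filter (fun j => I j ≠ 0)) (fun j => α j - 1)
    hβ m hJ
  set F : Fin (n + 1) → ℝ → ℝ := fun j θ =>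
    (X j (cos θ, sin θ)).1 * cos θ + (X j (cos θ, sin θ)).2 * sin θ with hF
  set G : Fin (n + 1) → ℝ → ℝ := fun j θ =>
    (X j (cos θ, sin θ)).2 * cos θ - (X j (cos θ, sin θ)).1 * sin θ with hG
  have hFc : ∀ j, Continuous (F j) := by
    intro j
    have := hcont j
    simp only [hF]
    fun_prop
  have hGc : ∀ j, Continuous (G j) := by
    intro j
    have := hcont j
    simp only [hG]
    fun_prop
  have hFp : ∀ j θ, F j (θ + 2 * π) = F j θ := by
    intro j θ
    simp only [hF, cos_add_two_pi, sin_add_two_pi]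
  have hGp : ∀ j θ, G j (θ + 2 * π) = G j θ := by
    intro j θ
    simp only [hG, cos_add_two_pi, sin_add_two_pi]
  set b : Fin (n + 1) → ℝ := fun j => if I j ≠ 0 then c j / I j else 0 with hb
  have hd : ∀ (H : Fin (n + 1) → ℝ → ℝ) (s θ : ℝ),
      HasDerivAt (fun s => ∑ j, b j * exp ((α j - 1) * s) * H j θ)
        (∑ j, b j * (α j - 1) * exp ((α j - 1) * s) * H j θ) s := by
    intro H s θ
    apply HasDerivAt.fun_sum
    intro j _
    have h1 : HasDerivAt (fun s : ℝ => (α j - 1) * s) (α j - 1) s := by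
      simpa using (hasDerivAt_id s).const_mul (α j - 1)
    have h2 := (h1.exp.const_mul (b j)).mul_const (H j θ)
    exact h2.congr_deriv (by ring)
  have hInt : ∀ e : Fin (n + 1) → ℝ, ∫ θ in (0:ℝ)..(2 * π), ∑ j, b j * e j * F j θ
      = ∑ j ∈ Finset.univ.filter (fun j => I j ≠ 0), c j * e j := by
    intro e
    rw [intervalIntegral.integral_finsetSum]
    · rw [Finset.sum_filter]
      apply Finset.sum_congr rfl
      intro j _
      rw [intervalIntegral.integral_const_mul, ← hI j]
      by_cases h : I j = 0
      · simp [h]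
      · simp only [hb, if_pos h, ne_eq, h, not_false_eq_true, if_true]
        field_simp
    · intro j _
      exact ((hFc j).const_mul _).intervalIntegrable _ _
  set Y : ℝ → ℝ × ℝ → ℝ × ℝ := fun ε p =>
    ((-p.2, p.1) : ℝ × ℝ) + ∑ j, (ε * b j) • X j p with hYdef
  have hX : ∀ j s θ, X j (exp s * cos θ, exp s * sin θ) =
      (exp s * (exp ((α j - 1) * s) * (F j θ * cos θ - G j θ * sin θ)),
       exp s * (exp ((α j - 1) * s) * (F j θ * sin θ + G j θ * cos θ))) := by
    intro j s θ
    have h1 : ((exp s * cos θ, exp s * sin θ) : ℝ × ℝ) = exp s • (cos θ, sin θ) := by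
      simp
    have h2 : exp s ^ (α j) = exp s * exp ((α j - 1) * s) := by
      rw [← Real.exp_mul, ← Real.exp_add]
      congr 1
      ring
    rw [h1, hhom j _ (exp_pos s).le, h2]
    have h3 := sin_sq_add_cos_sq θ
    ext
    · simp only [hF, hG, Prod.smul_fst, smul_eq_mul]
      linear_combination (-(exp s * exp ((α j - 1) * s) * (X j (cos θ, sin θ)).1)) * h3
    · simp only [hF, hG, Prod.smul_snd, smul_eq_mul]
      linear_combination (-(exp s * exp ((α j - 1) * s) * (X j (cos θ, sin θ)).2)) * h3
  have key : ∀ i : Fin m, ∀ᶠ ε in 𝓝[>] (0:ℝ), ∃ φ, IsLimitCycle (Y ε) φ ∧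
      ∀ t, ∃ s θ, |s - ((i : ℕ) : ℝ)| < 1 / 2 ∧ φ t = (exp s * cos θ, exp s * sin θ) := by
    intro i
    refine aux_root (fun s θ => ∑ j, b j * exp ((α j - 1) * s) * F j θ)
      (fun s θ => ∑ j, b j * exp ((α j - 1) * s) * G j θ)
      (fun s θ => ∑ j, b j * (α j - 1) * exp ((α j - 1) * s) * F j θ)
      (fun s θ => ∑ j, b j * (α j - 1) * exp ((α j - 1) * s) * G j θ)
      Y ?_ ?_ ?_ ?_ ?_ ?_ ?_ ?_ ?_ ?_ (hd F) (hd G) ((i : ℕ) : ℝ) (1 / 2) (by norm_num) ?_ ?_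
    · intro ε
      simp only [hYdef]
      fun_prop
    · intro ε s θ
      simp only [hYdef, hX]
      ext
      · simp only [Prod.fst_add, Prod.fst_sum, Prod.smul_fst, smul_eq_mul, Finset.mul_sum,
          Finset.sum_mul, mul_add, add_mul, mul_sub, sub_mul, Finset.sum_sub_distrib,
          Finset.sum_add_distrib]
        have e1 : ∀ j, ε * b j * (exp s * (exp ((α j - 1) * s) * (F j θ * cos θ))) =
          exp s * (ε * (b j * exp ((α j - 1) * s) * F j θ) * cos θ) := by intro j; ring
        have e2 : ∀ j, ε * b j * (exp s * (exp ((α j - 1) * s) * (G j θ * sin θ))) =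
          exp s * (ε * (b j * exp ((α j - 1) * s) * G j θ) * sin θ) := by intro j; ring
        simp only [mul_sub, sub_mul, one_mul] at e1 e2 ⊢
        simp only [e1, e2]
        ring
      · simp only [Prod.snd_add, Prod.snd_sum, Prod.smul_snd, smul_eq_mul, Finset.mul_sum,
          Finset.sum_mul, mul_add, add_mul, mul_sub, sub_mul, Finset.sum_sub_distrib,
          Finset.sum_add_distrib]
        have e1 : ∀ j, ε * b j * (exp s * (exp ((α j - 1) * s) * (F j θ * sin θ))) =
          exp s * (ε * (b j * exp ((α j - 1) * s) * F j θ) * sin θ) := by intro j; ring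
        have e2 : ∀ j, ε * b j * (exp s * (exp ((α j - 1) * s) * (G j θ * cos θ))) =
          exp s * (ε * (b j * exp ((α j - 1) * s) * G j θ) * cos θ) := by intro j; ring
        simp only [mul_sub, sub_mul, one_mul] at e1 e2 ⊢
        simp only [e1, e2]
        ring
    · fun_prop
    · fun_prop
    · fun_prop
    · fun_prop
    · intro s θ; simp only [hFp]
    · intro s θ; simp only [hGp]
    · intro s θ; simp only [hFp]
    · intro s θ; simp only [hGp]
    · rw [hInt (fun j => exp ((α j - 1) * ((i : ℕ) : ℝ)))]
      exact (hc i).1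
    · have := hInt (fun j => (α j - 1) * exp ((α j - 1) * ((i : ℕ) : ℝ)))
      simp only [← mul_assoc] at this
      rw [this]
      exact (hc i).2
  obtain ⟨ε, hε⟩ := (Filter.eventually_all.2 key).exists
  choose φ hφ1 hφ2 using hε
  refine ⟨fun j => ε * b j, φ, hφ1, ?_⟩
  intro i j hij heq
  apply hij
  have hmem : φ i 0 ∈ Set.range (φ j) := heq ▸ Set.mem_range_self 0
  obtain ⟨t, ht⟩ := hmem
  obtain ⟨s, θ, hs, e⟩ := hφ2 i 0
  obtain ⟨s', θ', hs', e'⟩ := hφ2 j t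
  rw [ht, e, Prod.mk.injEq] at e'
  have h1 := aux_sq s θ
  rw [e'.1, e'.2, aux_sq] at h1
  have h2 := Real.exp_injective h1
  have h3 : s' = s := by linarith
  subst h3
  rw [abs_lt] at hs hs'
  have h4 : ((i : ℕ) : ℝ) < ((j : ℕ) : ℝ) + 1 := by linarith [hs.1, hs.2, hs'.1, hs'.2]
  have h5 : ((j : ℕ) : ℝ) < ((i : ℕ) : ℝ) + 1 := by linarith [hs.1, hs.2, hs'.1, hs'.2]
  have h4' : (i : ℕ) < (j : ℕ) + 1 := by exact_mod_cast h4
  have h5' : (j : ℕ) < (i : ℕ) + 1 := by exact_mod_cast h5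
  apply Fin.ext
  omega
end
end

section
/- Consider the family of planar vector fields X(x,y) = (-y, x) + Σ_{j=0}^{n} a_j X_j(x,y), where a ∈ ℝ^{n+1} and for each j, X_j = (f_j, g_j) is a fixed homogeneous vector field of class C¹ with degree of homogeneity α_j ∈ ℝ, 0 ≤ α_0 < α_1 < ... < α_n. Define I_j = ∫_0^{2π} ( f_j(cos θ, sin θ) cos θ + g_j(cos θ, sin θ) sin θ ) dθ, and let m + 1 be the number of indices j with I_j ≠ 0. Then there exist values of a such that the system (ẋ, ẏ) = X(x,y) has at least m hyperbolic limit cycles. -/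
open Real Set

noncomputable section

/-- The divergence of a planar vector field. -/
def Divergence (X : ℝ × ℝ → ℝ × ℝ) (p : ℝ × ℝ) : ℝ :=
  (fderiv ℝ X p (1, 0)).1 + (fderiv ℝ X p (0, 1)).2

/-- A limit cycle of a `C¹` planar vector field is hyperbolic when the derivative of the
Poincaré return map at the corresponding fixed point differs from `1`; for a `C¹` field this
derivative equals `exp (∫_0^T div X (φ(t)) dt)`, so hyperbolicity amounts to the
non-vanishing of the integral of the divergence along the cycle (over any period `T`). -/
def IsHyperbolicLimitCycle (X : ℝ × ℝ → ℝ × ℝ) (φ : ℝ → ℝ × ℝ) : Prop :=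
  IsLimitCycle X φ ∧
    ∀ T > 0, Function.Periodic φ T → (∫ t in (0:ℝ)..T, Divergence X (φ t)) ≠ 0

/-- The system `(ẋ,ẏ) = X(x,y)` has at least `N` (pairwise distinct) hyperbolic limit
cycles. -/
def HasAtLeastNHyperbolicLimitCycles (X : ℝ × ℝ → ℝ × ℝ) (N : ℕ) : Prop :=
  ∃ φ : Fin N → ℝ → ℝ × ℝ, (∀ i, IsHyperbolicLimitCycle X (φ i)) ∧
    ∀ i j, i ≠ j → Set.range (φ i) ≠ Set.range (φ j)


open Filter Topology

/-! ### Polar components of a planar field -/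

/-- radial component -/
def polR (Y : ℝ × ℝ → ℝ × ℝ) (r θ : ℝ) : ℝ :=
  (Y (r * cos θ, r * sin θ)).1 * cos θ + (Y (r * cos θ, r * sin θ)).2 * sin θ

/-- tangential component -/
def polS (Y : ℝ × ℝ → ℝ × ℝ) (r θ : ℝ) : ℝ :=
  (Y (r * cos θ, r * sin θ)).2 * cos θ - (Y (r * cos θ, r * sin θ)).1 * sin θ

/-- radial derivative of the radial component -/
def polRr (Y : ℝ × ℝ → ℝ × ℝ) (r θ : ℝ) : ℝ :=
  (fderiv ℝ Y (r * cos θ, r * sin θ) (cos θ, sin θ)).1 * cos θ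
    + (fderiv ℝ Y (r * cos θ, r * sin θ) (cos θ, sin θ)).2 * sin θ

/-- radial derivative of the tangential component -/
def polSr (Y : ℝ × ℝ → ℝ × ℝ) (r θ : ℝ) : ℝ :=
  (fderiv ℝ Y (r * cos θ, r * sin θ) (cos θ, sin θ)).2 * cos θ
    - (fderiv ℝ Y (r * cos θ, r * sin θ) (cos θ, sin θ)).1 * sin θ

/-- angular derivative of the tangential component -/
def polSt (Y : ℝ × ℝ → ℝ × ℝ) (r θ : ℝ) : ℝ :=
  ((fderiv ℝ Y (r * cos θ, r * sin θ) (-(r * sin θ), r * cos θ)).2 * cos θ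
    - (fderiv ℝ Y (r * cos θ, r * sin θ) (-(r * sin θ), r * cos θ)).1 * sin θ) - polR Y r θ

/-- angular speed -/
def polB (Y : ℝ × ℝ → ℝ × ℝ) (ε r θ : ℝ) : ℝ := 1 + ε * polS Y r θ / r

/-- slope -/
def polG (Y : ℝ × ℝ → ℝ × ℝ) (ε r θ : ℝ) : ℝ := polR Y r θ / polB Y ε r θ

/-- radial derivative of the slope -/
def polGr (Y : ℝ × ℝ → ℝ × ℝ) (ε r θ : ℝ) : ℝ :=
  (polRr Y r θ * polB Y ε r θ
    - polR Y r θ * (ε * ((polSr Y r θ * r - polS Y r θ) / r ^ 2))) / polB Y ε r θ ^ 2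

lemma hd_fst {c : ℝ → ℝ × ℝ} {c' : ℝ × ℝ} {t : ℝ} (h : HasDerivAt c c' t) :
    HasDerivAt (fun s => (c s).1) c'.1 t :=
  (ContinuousLinearMap.fst ℝ ℝ ℝ).hasFDerivAt.comp_hasDerivAt t h

lemma hd_snd {c : ℝ → ℝ × ℝ} {c' : ℝ × ℝ} {t : ℝ} (h : HasDerivAt c c' t) :
    HasDerivAt (fun s => (c s).2) c'.2 t :=
  (ContinuousLinearMap.snd ℝ ℝ ℝ).hasFDerivAt.comp_hasDerivAt t h

section polar
variable {Y : ℝ × ℝ → ℝ × ℝ}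

lemma polR_cont (hY : ContDiff ℝ 1 Y) : Continuous (fun p : ℝ × ℝ => polR Y p.1 p.2) := by
  have := hY.continuous
  unfold polR; fun_prop

lemma polS_cont (hY : ContDiff ℝ 1 Y) : Continuous (fun p : ℝ × ℝ => polS Y p.1 p.2) := by
  have := hY.continuous
  unfold polS; fun_prop

lemma fd_cont (hY : ContDiff ℝ 1 Y) {α : Type*} [TopologicalSpace α] {u v : α → ℝ × ℝ}
    (hu : Continuous u) (hv : Continuous v) :
    Continuous (fun x => fderiv ℝ Y (u x) (v x)) :=
  ((hY.continuous_fderiv one_ne_zero).comp hu).clm_apply hv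

lemma polRr_cont (hY : ContDiff ℝ 1 Y) : Continuous (fun p : ℝ × ℝ => polRr Y p.1 p.2) := by
  have := fd_cont hY (u := fun p : ℝ × ℝ => (p.1 * cos p.2, p.1 * sin p.2))
    (v := fun p : ℝ × ℝ => (cos p.2, sin p.2)) (by fun_prop) (by fun_prop)
  unfold polRr; fun_prop

lemma polSr_cont (hY : ContDiff ℝ 1 Y) : Continuous (fun p : ℝ × ℝ => polSr Y p.1 p.2) := by
  have := fd_cont hY (u := fun p : ℝ × ℝ => (p.1 * cos p.2, p.1 * sin p.2))
    (v := fun p : ℝ × ℝ => (cos p.2, sin p.2)) (by fun_prop) (by fun_prop)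
  unfold polSr; fun_prop

lemma polSt_cont (hY : ContDiff ℝ 1 Y) : Continuous (fun p : ℝ × ℝ => polSt Y p.1 p.2) := by
  have := fd_cont hY (u := fun p : ℝ × ℝ => (p.1 * cos p.2, p.1 * sin p.2))
    (v := fun p : ℝ × ℝ => (-(p.1 * sin p.2), p.1 * cos p.2)) (by fun_prop) (by fun_prop)
  have := polR_cont hY
  unfold polSt; fun_prop

lemma div_cont (hY : ContDiff ℝ 1 Y) : Continuous (Divergence Y) := by
  have h1 := fd_cont hY (u := fun p : ℝ × ℝ => p)
    (v := fun p : ℝ × ℝ => (1, 0)) (by fun_prop) (by fun_prop)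
  have h2 := fd_cont hY (u := fun p : ℝ × ℝ => p)
    (v := fun p : ℝ × ℝ => (0, 1)) (by fun_prop) (by fun_prop)
  unfold Divergence; fun_prop

lemma Y_hasDeriv (hY : ContDiff ℝ 1 Y) {c : ℝ → ℝ × ℝ} {c' : ℝ × ℝ} {t : ℝ}
    (hc : HasDerivAt c c' t) : HasDerivAt (fun s => Y (c s)) (fderiv ℝ Y (c t) c') t :=
  ((hY.differentiable one_ne_zero) (c t)).hasFDerivAt.comp_hasDerivAt t hc

lemma polR_hasDeriv (hY : ContDiff ℝ 1 Y) (r θ : ℝ) :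
    HasDerivAt (fun r => polR Y r θ) (polRr Y r θ) r := by
  have hc : HasDerivAt (fun r : ℝ => (r * cos θ, r * sin θ)) (cos θ, sin θ) r := by
    simpa using ((hasDerivAt_id r).mul_const (cos θ)).prodMk ((hasDerivAt_id r).mul_const (sin θ))
  have h := Y_hasDeriv hY hc
  exact ((hd_fst h).mul_const _).add ((hd_snd h).mul_const _)

lemma polS_hasDeriv (hY : ContDiff ℝ 1 Y) (r θ : ℝ) :
    HasDerivAt (fun r => polS Y r θ) (polSr Y r θ) r := by
  have hc : HasDerivAt (fun r : ℝ => (r * cos θ, r * sin θ)) (cos θ, sin θ) r := by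
    simpa using ((hasDerivAt_id r).mul_const (cos θ)).prodMk ((hasDerivAt_id r).mul_const (sin θ))
  have h := Y_hasDeriv hY hc
  exact ((hd_snd h).mul_const _).sub ((hd_fst h).mul_const _)

lemma polS_hasDeriv_t (hY : ContDiff ℝ 1 Y) (r θ : ℝ) :
    HasDerivAt (fun θ => polS Y r θ) (polSt Y r θ) θ := by
  have hc : HasDerivAt (fun θ : ℝ => (r * cos θ, r * sin θ)) (-(r * sin θ), r * cos θ) θ := by
    simpa using ((hasDerivAt_cos θ).const_mul r).prodMk ((hasDerivAt_sin θ).const_mul r)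
  have h := Y_hasDeriv hY hc
  refine (((hd_snd h).mul (hasDerivAt_cos θ)).sub ((hd_fst h).mul (hasDerivAt_sin θ))).congr_deriv ?_
  simp only [polSt, polR]; ring

lemma div_polar (r θ : ℝ) :
    r * Divergence Y (r * cos θ, r * sin θ) = r * polRr Y r θ + polR Y r θ + polSt Y r θ := by
  have key : ∀ a b : ℝ, fderiv ℝ Y (r * cos θ, r * sin θ) (a, b) =
      a • fderiv ℝ Y (r * cos θ, r * sin θ) (1, 0) + b • fderiv ℝ Y (r * cos θ, r * sin θ) (0, 1) := by
    intro a b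
    rw [← map_smul, ← map_smul, ← map_add]; simp
  simp only [Divergence, polRr, polSt]
  rw [key (cos θ), key (-(r * sin θ))]
  simp only [Prod.fst_add, Prod.snd_add, Prod.smul_fst, Prod.smul_snd, smul_eq_mul]
  linear_combination (-r * ((fderiv ℝ Y (r * cos θ, r * sin θ) (1, 0)).1 +
    (fderiv ℝ Y (r * cos θ, r * sin θ) (0, 1)).2)) * sin_sq_add_cos_sq θ

lemma polG_hasDeriv (hY : ContDiff ℝ 1 Y) (ε r θ : ℝ) (hr : r ≠ 0) (hB : polB Y ε r θ ≠ 0) :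
    HasDerivAt (fun r => polG Y ε r θ) (polGr Y ε r θ) r := by
  have h1 : HasDerivAt (fun r => polB Y ε r θ) (ε * ((polSr Y r θ * r - polS Y r θ) / r ^ 2)) r := by
    have := (((polS_hasDeriv hY r θ).div (hasDerivAt_id r) hr).const_mul ε).const_add 1
    refine (this.congr_of_eventuallyEq (Eventually.of_forall fun x => ?_)).congr_deriv ?_
    · simp [polB, mul_div_assoc]
    · simp
  exact (polR_hasDeriv hY r θ).div h1 hB

lemma integral_div (hY : ContDiff ℝ 1 Y) (r : ℝ) (hr : 0 < r)
    (h0 : ∫ θ in (0:ℝ)..(2 * π), polR Y r θ = 0) :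
    ∫ θ in (0:ℝ)..(2 * π), Divergence Y (r * cos θ, r * sin θ) =
      ∫ θ in (0:ℝ)..(2 * π), polRr Y r θ := by
  have c1 : Continuous (fun θ => polR Y r θ) := (polR_cont hY).comp (by fun_prop : Continuous fun θ : ℝ => (r, θ))
  have c2 : Continuous (fun θ => polRr Y r θ) := (polRr_cont hY).comp (by fun_prop : Continuous fun θ : ℝ => (r, θ))
  have c3 : Continuous (fun θ => polSt Y r θ) := (polSt_cont hY).comp (by fun_prop : Continuous fun θ : ℝ => (r, θ))
  have h3 : ∫ θ in (0:ℝ)..(2 * π), polSt Y r θ = 0 := by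
    rw [intervalIntegral.integral_eq_sub_of_hasDerivAt (fun θ _ => polS_hasDeriv_t hY r θ)
      (c3.intervalIntegrable _ _)]
    simp [polS]
  have : ∫ θ in (0:ℝ)..(2 * π), r * Divergence Y (r * cos θ, r * sin θ) =
      ∫ θ in (0:ℝ)..(2 * π), (r * polRr Y r θ + polR Y r θ + polSt Y r θ) := by
    congr 1; ext θ; exact div_polar r θ
  have i2 : Continuous (fun θ => r * polRr Y r θ) := continuous_const.mul c2
  have i1 : Continuous (fun θ => r * polRr Y r θ + polR Y r θ) := i2.add c1
  rw [intervalIntegral.integral_add (i1.intervalIntegrable _ _) (c3.intervalIntegrable _ _),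
    intervalIntegral.integral_add (i2.intervalIntegrable _ _)
    (c1.intervalIntegrable _ _), h3, h0] at this
  simp only [intervalIntegral.integral_const_mul, add_zero] at this
  exact mul_left_cancel₀ hr.ne' this

/-- uniformity in the angle -/
lemma unif_angle {F : ℝ × ℝ → ℝ → ℝ} (q₀ : ℝ × ℝ)
    (hF : ∀ θ, ContinuousAt (fun z : (ℝ × ℝ) × ℝ => F z.1 z.2) (q₀, θ))
    (hp : ∀ q θ, F q (θ + 2 * π) = F q θ) {η : ℝ} (hη : 0 < η) :
    ∀ᶠ q in 𝓝 q₀, ∀ θ, |F q θ - F q₀ θ| < η := by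
  have h := (isCompact_Icc (a := (0:ℝ)) (b := 2 * π)).eventually_forall_of_forall_eventually
    (x₀ := q₀) (P := fun q θ => |F q θ - F q₀ θ| < η) ?_
  · filter_upwards [h] with q hq θ
    have hper : Function.Periodic (fun θ => F q θ - F q₀ θ) (2 * π) := fun θ => by
      simp only [hp]
    obtain ⟨y, hy, he⟩ := hper.exists_mem_Ico₀ (by positivity) θ
    rw [he]; exact hq y ⟨hy.1, hy.2.le⟩
  · intro θ _
    have h1 : ContinuousAt (fun z : (ℝ × ℝ) × ℝ => F q₀ z.2) (q₀, θ) := by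
      have : ContinuousAt (fun z : (ℝ × ℝ) × ℝ => (q₀, z.2)) (q₀, θ) := by fun_prop
      exact ContinuousAt.comp (f := fun z : (ℝ × ℝ) × ℝ => (q₀, z.2)) (x := (q₀, θ)) (hF θ) this
    have h2 := ((hF θ).sub h1).abs
    have := h2.eventually_lt (continuousAt_const (y := η)) (by simpa using hη)
    exact this

lemma polB_cont (hY : ContDiff ℝ 1 Y) (q : ℝ × ℝ) (hq : q.2 ≠ 0) (θ : ℝ) :
    ContinuousAt (fun z : (ℝ × ℝ) × ℝ => polB Y z.1.1 z.1.2 z.2) (q, θ) := by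
  have := (polS_cont hY).comp (by fun_prop : Continuous fun z : (ℝ × ℝ) × ℝ => (z.1.2, z.2))
  have := this.continuousAt (x := (q, θ))
  unfold polB
  refine continuousAt_const.add (ContinuousAt.div (ContinuousAt.mul (by fun_prop) this)
    (by fun_prop) hq)

lemma polG_cont (hY : ContDiff ℝ 1 Y) (q : ℝ × ℝ) (hq : q.2 ≠ 0) (θ : ℝ)
    (hB : polB Y q.1 q.2 θ ≠ 0) :
    ContinuousAt (fun z : (ℝ × ℝ) × ℝ => polG Y z.1.1 z.1.2 z.2) (q, θ) := by
  have := (polR_cont hY).comp (by fun_prop : Continuous fun z : (ℝ × ℝ) × ℝ => (z.1.2, z.2))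
  have := this.continuousAt (x := (q, θ))
  exact this.div (polB_cont hY q hq θ) hB

lemma polGr_cont (hY : ContDiff ℝ 1 Y) (q : ℝ × ℝ) (hq : q.2 ≠ 0) (θ : ℝ)
    (hB : polB Y q.1 q.2 θ ≠ 0) :
    ContinuousAt (fun z : (ℝ × ℝ) × ℝ => polGr Y z.1.1 z.1.2 z.2) (q, θ) := by
  have hm := (by fun_prop : Continuous fun z : (ℝ × ℝ) × ℝ => (z.1.2, z.2))
  have h1 := ((polR_cont hY).comp hm).continuousAt (x := (q, θ))
  have h2 := ((polS_cont hY).comp hm).continuousAt (x := (q, θ))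
  have h3 := ((polRr_cont hY).comp hm).continuousAt (x := (q, θ))
  have h4 := ((polSr_cont hY).comp hm).continuousAt (x := (q, θ))
  have hb := polB_cont hY q hq θ
  refine ContinuousAt.div ((h3.mul hb).sub (h1.mul (ContinuousAt.mul (by fun_prop)
    (ContinuousAt.div ((h4.mul (by fun_prop)).sub h2) (by fun_prop) ?_)))) (hb.pow 2) ?_
  · exact pow_ne_zero 2 hq
  · exact pow_ne_zero 2 hB

lemma polR_per (r θ : ℝ) : polR Y r (θ + 2 * π) = polR Y r θ := by simp [polR]
lemma polS_per (r θ : ℝ) : polS Y r (θ + 2 * π) = polS Y r θ := by simp [polS]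
lemma polRr_per (r θ : ℝ) : polRr Y r (θ + 2 * π) = polRr Y r θ := by simp [polRr]
lemma polB_per (ε r θ : ℝ) : polB Y ε r (θ + 2 * π) = polB Y ε r θ := by simp [polB, polS]
lemma polG_per (ε r θ : ℝ) : polG Y ε r (θ + 2 * π) = polG Y ε r θ := by
  simp [polG, polR_per, polB_per]
lemma polGr_per (ε r θ : ℝ) : polGr Y ε r (θ + 2 * π) = polGr Y ε r θ := by
  simp [polGr, polR_per, polB_per, polRr, polS, polSr]

lemma polB_zero (r θ : ℝ) : polB Y 0 r θ = 1 := by simp [polB]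
lemma polG_zero (r θ : ℝ) : polG Y 0 r θ = polR Y r θ := by simp [polG, polB_zero]
lemma polGr_zero (r θ : ℝ) : polGr Y 0 r θ = polRr Y r θ := by simp [polGr, polB_zero]

/-- all uniform estimates near `(0, r₀)` -/
lemma good_box (hY : ContDiff ℝ 1 Y) {r₀ η : ℝ} (hr : 0 < r₀) (hη : 0 < η) :
    ∃ δ₀ > 0, δ₀ < r₀ ∧ ∀ ε r θ, |ε| ≤ δ₀ → |r - r₀| ≤ δ₀ →
      (1 / 2 ≤ polB Y ε r θ ∧ polB Y ε r θ ≤ 2) ∧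
      |polGr Y ε r θ - polRr Y r₀ θ| ≤ η ∧
      |Divergence Y (r * cos θ, r * sin θ)
        - Divergence Y (r₀ * cos θ, r₀ * sin θ) * polB Y ε r θ| ≤ η * polB Y ε r θ ∧
      |polG Y ε r θ - polR Y r₀ θ| ≤ 1 := by
  have e1 := unif_angle (F := fun q θ => polB Y q.1 q.2 θ) (0, r₀)
    (fun θ => polB_cont hY _ hr.ne' θ) (fun q θ => polB_per _ _ _) (η := 1/2) (by norm_num)
  have e2 := unif_angle (F := fun q θ => polGr Y q.1 q.2 θ) (0, r₀)
    (fun θ => polGr_cont hY _ hr.ne' θ (by simp [polB_zero])) (fun q θ => polGr_per _ _ _) hη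
  have e4 := unif_angle (F := fun q θ => polG Y q.1 q.2 θ) (0, r₀)
    (fun θ => polG_cont hY _ hr.ne' θ (by simp [polB_zero])) (fun q θ => polG_per _ _ _) one_pos
  have e3 := unif_angle (F := fun q θ => Divergence Y (q.2 * cos θ, q.2 * sin θ)
        - Divergence Y (r₀ * cos θ, r₀ * sin θ) * polB Y q.1 q.2 θ) (0, r₀)
    (fun θ => by
      have := div_cont hY
      have hb := polB_cont hY (0, r₀) hr.ne' θ
      exact ContinuousAt.sub (by fun_prop) (ContinuousAt.mul (by fun_prop) hb))
    (fun q θ => by simp [polB_per]) (half_pos hη)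
  obtain ⟨d, hd, H⟩ := Metric.eventually_nhds_iff.1 ((e1.and e2).and (e3.and e4))
  refine ⟨min (d / 2) (r₀ / 2), by positivity, ?_, ?_⟩
  · exact lt_of_le_of_lt (min_le_right _ _) (by linarith)
  intro ε r θ h1 h2
  have hq : dist ((ε, r) : ℝ × ℝ) (0, r₀) < d := by
    rw [Prod.dist_eq]
    simp only [Real.dist_eq, sub_zero]
    exact max_lt (lt_of_le_of_lt (h1.trans (min_le_left _ _)) (by linarith))
      (lt_of_le_of_lt (h2.trans (min_le_left _ _)) (by linarith))
  obtain ⟨⟨a1, a2⟩, a3, a4⟩ := H hq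
  have a1 := a1 θ; have a2 := a2 θ; have a3 := a3 θ; have a4 := a4 θ
  simp only [polB_zero, polG_zero, polGr_zero] at a1 a2 a3 a4
  have b1 := abs_lt.1 a1
  have hB : 1 / 2 ≤ polB Y ε r θ := by linarith
  refine ⟨⟨hB, by linarith⟩, a2.le, ?_, a4.le⟩
  have : η / 2 ≤ η * polB Y ε r θ := by nlinarith
  simp only [mul_one, sub_self, sub_zero] at a3
  linarith

end polar


/-! ### Elementary one-variable lemmas -/

lemma surj_of_deriv {f f' : ℝ → ℝ} (hf : ∀ t, HasDerivAt f (f' t) t) (h : ∀ t, 1 / 2 ≤ f' t) :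
    Function.Surjective f := by
  have hmono : Monotone (fun t => f t - t / 2) := by
    have hd : ∀ t, HasDerivAt (fun t => f t - t / 2) (f' t - 1 / 2) t := fun t =>
      (hf t).sub ((hasDerivAt_id t).div_const 2)
    refine monotone_of_deriv_nonneg (fun t => (hd t).differentiableAt) (fun t => ?_)
    rw [(hd t).deriv]; linarith [h t]
  have hc : Continuous f := continuous_iff_continuousAt.2 fun t => (hf t).continuousAt
  refine hc.surjective ?_ ?_
  · refine tendsto_atTop_mono' (f₁ := fun t => f 0 + t / 2) _ ?_ ?_
    · filter_upwards [eventually_ge_atTop 0] with t ht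
      have := hmono ht
      simp only at this
      linarith
    · exact tendsto_atTop_add_const_left _ _ (tendsto_id.atTop_div_const (by norm_num))
  · refine tendsto_atBot_mono' (f₁ := fun t => f 0 + t / 2) _ ?_ ?_
    · filter_upwards [eventually_le_atBot 0] with t ht
      have := hmono ht
      simp only at this
      linarith
    · exact tendsto_atBot_add_const_left _ _ (tendsto_id.atBot_div_const (by norm_num))

lemma lift_curve {x y x' y' : ℝ → ℝ} (hx : ∀ t, HasDerivAt x (x' t) t)
    (hy : ∀ t, HasDerivAt y (y' t) t) (hx' : Continuous x') (hy' : Continuous y')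
    (hpos : ∀ t, 0 < x t ^ 2 + y t ^ 2) :
    ∃ θ : ℝ → ℝ, ∀ t, x t = √(x t ^ 2 + y t ^ 2) * cos (θ t) ∧
      y t = √(x t ^ 2 + y t ^ 2) * sin (θ t) ∧
      HasDerivAt θ ((x t * y' t - y t * x' t) / (x t ^ 2 + y t ^ 2)) t := by
  have hxc : Continuous x := continuous_iff_continuousAt.2 fun t => (hx t).continuousAt
  have hyc : Continuous y := continuous_iff_continuousAt.2 fun t => (hy t).continuousAt
  set w : ℝ → ℝ := fun t => (x t * y' t - y t * x' t) / (x t ^ 2 + y t ^ 2) with hw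
  have hwc : Continuous w := by
    refine Continuous.div (by fun_prop) (by fun_prop) (fun t => (hpos t).ne')
  obtain ⟨θ₀, h1, h2⟩ : ∃ θ₀, x 0 = √(x 0 ^ 2 + y 0 ^ 2) * cos θ₀ ∧
      y 0 = √(x 0 ^ 2 + y 0 ^ 2) * sin θ₀ := by
    refine ⟨Complex.arg ⟨x 0, y 0⟩, ?_, ?_⟩
    · have := Complex.norm_mul_cos_arg ⟨x 0, y 0⟩
      rw [Complex.norm_eq_sqrt_sq_add_sq] at this; exact this.symm
    · have := Complex.norm_mul_sin_arg ⟨x 0, y 0⟩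
      rw [Complex.norm_eq_sqrt_sq_add_sq] at this; exact this.symm
  set θ : ℝ → ℝ := fun t => θ₀ + ∫ s in (0:ℝ)..t, w s with hθ
  have hθd : ∀ t, HasDerivAt θ (w t) t := fun t =>
    (intervalIntegral.integral_hasDerivAt_right (hwc.intervalIntegrable _ _)
      (hwc.stronglyMeasurableAtFilter _ _) hwc.continuousAt).const_add θ₀
  set ρ : ℝ → ℝ := fun t => √(x t ^ 2 + y t ^ 2) with hρ
  have hρpos : ∀ t, 0 < ρ t := fun t => Real.sqrt_pos.2 (hpos t)
  have hρ2 : ∀ t, ρ t ^ 2 = x t ^ 2 + y t ^ 2 := fun t => Real.sq_sqrt (hpos t).le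
  have hρd : ∀ t, HasDerivAt ρ ((x t * x' t + y t * y' t) / ρ t) t := fun t => by
    have := (((hx t).pow 2).add ((hy t).pow 2)).sqrt (hpos t).ne'
    refine this.congr_deriv ?_
    simp only [hρ, Pi.add_apply, Pi.pow_apply]
    have := (hρpos t).ne'
    simp only [hρ] at this
    field_simp
    ring
  have hca : ∀ t, HasDerivAt (fun t => (x t * cos (θ t) + y t * sin (θ t)) / ρ t) 0 t := fun t => by
    have := (((hx t).mul (hθd t).cos).add ((hy t).mul (hθd t).sin)).div (hρd t) (hρpos t).ne'
    refine this.congr_deriv ?_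
    have h0 := (hρpos t).ne'
    simp only [hw, ← hρ2]
    field_simp
    simp only [Pi.add_apply, Pi.mul_apply, hρ2]
    ring
  have hcc : ∀ t, HasDerivAt (fun t => (y t * cos (θ t) - x t * sin (θ t)) / ρ t) 0 t := fun t => by
    have := (((hy t).mul (hθd t).cos).sub ((hx t).mul (hθd t).sin)).div (hρd t) (hρpos t).ne'
    refine this.congr_deriv ?_
    have h0 := (hρpos t).ne'
    simp only [hw, ← hρ2]
    field_simp
    simp only [Pi.sub_apply, Pi.mul_apply, hρ2]
    ring
  have hθ0 : θ 0 = θ₀ := by simp [hθ]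
  have ka : ∀ t, x t * cos (θ t) + y t * sin (θ t) = ρ t := fun t => by
    have := is_const_of_deriv_eq_zero (fun t => (hca t).differentiableAt) (fun t => (hca t).deriv) t 0
    simp only [hθ0] at this
    rw [div_eq_iff (hρpos t).ne'] at this
    rw [this]
    have h3 : x 0 * cos θ₀ + y 0 * sin θ₀ = ρ 0 := by
      calc _ = (ρ 0 * cos θ₀) * cos θ₀ + (ρ 0 * sin θ₀) * sin θ₀ := by rw [← h1, ← h2]
        _ = _ := by linear_combination ρ 0 * sin_sq_add_cos_sq θ₀
    rw [h3, div_self (hρpos 0).ne', one_mul]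
  have kc : ∀ t, y t * cos (θ t) - x t * sin (θ t) = 0 := fun t => by
    have := is_const_of_deriv_eq_zero (fun t => (hcc t).differentiableAt) (fun t => (hcc t).deriv) t 0
    simp only [hθ0] at this
    rw [div_eq_iff (hρpos t).ne'] at this
    rw [this]
    have h3 : y 0 * cos θ₀ - x 0 * sin θ₀ = 0 := by
      calc _ = (ρ 0 * sin θ₀) * cos θ₀ - (ρ 0 * cos θ₀) * sin θ₀ := by rw [← h1, ← h2]
        _ = _ := by ring
    rw [h3]; simp
  refine ⟨θ, fun t => ⟨?_, ?_, hθd t⟩⟩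
  · change x t = ρ t * _
    rw [← ka t]
    linear_combination (-x t) * sin_sq_add_cos_sq (θ t) - sin (θ t) * kc t
  · change y t = ρ t * _
    rw [← ka t]
    linear_combination (-y t) * sin_sq_add_cos_sq (θ t) + cos (θ t) * kc t

/-- `E(θ + 2πk) = E(θ) + kK` -/
lemma prim_shift {D : ℝ → ℝ} (hD : Continuous D) (hp : ∀ θ, D (θ + 2 * π) = D θ) (θ : ℝ) (k : ℤ) :
    (∫ s in (0:ℝ)..(θ + k * (2 * π)), D s) = (∫ s in (0:ℝ)..θ, D s)
      + k * ∫ s in (0:ℝ)..(2 * π), D s := by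
  have hper : Function.Periodic D (2 * π) := hp
  have h1 := hper.intervalIntegral_add_zsmul_eq k θ (fun a b => hD.intervalIntegrable a b)
  rw [hper.intervalIntegral_add_eq θ 0, zero_add] at h1
  simp only [zsmul_eq_mul] at h1
  rw [← h1, intervalIntegral.integral_add_adjacent_intervals (hD.intervalIntegrable _ _)
    (hD.intervalIntegrable _ _)]

/-- scalar uniqueness -/
lemma scalar_unique {D d γ θ θ' : ℝ → ℝ} {ε η T : ℝ} {k : ℤ} (hD : Continuous D)
    (hp : ∀ θ, D (θ + 2 * π) = D θ) (hε : 0 < ε) (hT : 0 < T) (hk : 0 < k)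
    (hd : ∀ t, HasDerivAt d (ε * θ' t * γ t) t) (hθ : ∀ t, HasDerivAt θ (θ' t) t)
    (hθ' : ∀ t, 0 ≤ θ' t) (hγ : ∀ t, |γ t - D (θ t) * d t| ≤ η * |d t|)
    (hdT : ∀ t, d (t + T) = d t) (hθT : ∀ t, θ (t + T) = θ t + k * (2 * π))
    (hη : 2 * π * η < |∫ s in (0:ℝ)..(2 * π), D s|) (t : ℝ) : d t = 0 := by
  set K := ∫ s in (0:ℝ)..(2 * π), D s with hK
  obtain ⟨s, hs, hsK⟩ : ∃ s : ℝ, (s = 1 ∨ s = -1) ∧ s * K = |K| := by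
    rcases le_total 0 K with h | h
    · exact ⟨1, Or.inl rfl, by rw [abs_of_nonneg h, one_mul]⟩
    · exact ⟨-1, Or.inr rfl, by rw [abs_of_nonpos h]; ring⟩
  have hs2 : s * s = 1 := by rcases hs with rfl | rfl <;> norm_num
  set E : ℝ → ℝ := fun x => ∫ u in (0:ℝ)..x, D u with hE
  have hEd : ∀ x, HasDerivAt E (D x) x := fun x =>
    intervalIntegral.integral_hasDerivAt_right (hD.intervalIntegrable _ _)
      (hD.stronglyMeasurableAtFilter _ _) hD.continuousAt
  set V : ℝ → ℝ := fun t => d t ^ 2 * exp (-(2 * ε) * (E (θ t) - s * η * θ t)) with hV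
  have hVd : ∀ t, HasDerivAt V (2 * ε * θ' t * exp (-(2 * ε) * (E (θ t) - s * η * θ t)) *
      (d t * (γ t - D (θ t) * d t) + s * η * d t ^ 2)) t := fun t => by
    have h1 : HasDerivAt (fun t => E (θ t)) (D (θ t) * θ' t) t := (hEd (θ t)).comp t (hθ t)
    have h2 := ((hd t).pow 2).mul (((h1.sub ((hθ t).const_mul (s * η))).const_mul (-(2 * ε))).exp)
    refine h2.congr_deriv ?_
    simp only [Pi.pow_apply, Pi.sub_apply]
    push_cast
    ring
  have hmono : Monotone (fun t => s * V t) := by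
    refine monotone_of_deriv_nonneg (fun t => ((hVd t).const_mul s).differentiableAt) (fun t => ?_)
    rw [((hVd t).const_mul s).deriv]
    have h1 : |d t * (γ t - D (θ t) * d t)| ≤ η * d t ^ 2 := by
      rw [abs_mul, ← sq_abs]
      nlinarith [hγ t, abs_nonneg (d t)]
    have h2 := abs_le.1 h1
    have h3 : 0 ≤ s * (d t * (γ t - D (θ t) * d t) + s * η * d t ^ 2) := by
      have : s * (d t * (γ t - D (θ t) * d t) + s * η * d t ^ 2) =
        s * (d t * (γ t - D (θ t) * d t)) + η * d t ^ 2 := by linear_combination η * d t ^ 2 * hs2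
      rw [this]
      rcases hs with rfl | rfl <;> linarith [h2.1, h2.2]
    have h4 : 0 ≤ 2 * ε * θ' t * exp (-(2 * ε) * (E (θ t) - s * η * θ t)) := by
      have := hθ' t
      positivity
    nlinarith [mul_nonneg h4 h3]
  have hVT : V (t + T) = V t * exp (-(2 * ε) * (k * (K - s * (2 * π * η)))) := by
    have := prim_shift hD hp (θ t) k
    simp only [hV, hE, hdT, hθT]
    rw [mul_assoc (d t ^ 2), ← Real.exp_add, this]
    congr 2
    ring
  have hm := hmono (show t ≤ t + T by linarith)
  simp only [hVT] at hm
  have hk' : (0:ℝ) < k := by exact_mod_cast hk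
  have hx : 0 < 2 * ε * (k * (|K| - 2 * π * η)) := by
    have : 0 < |K| - 2 * π * η := by linarith
    positivity
  have hV0 : V t = 0 := by
    have hVn : 0 ≤ V t := by positivity
    by_contra hne
    have hVp : 0 < V t := lt_of_le_of_ne hVn (Ne.symm hne)
    rcases hs with rfl | rfl
    · have : exp (-(2 * ε) * (k * (K - 1 * (2 * π * η)))) < 1 := by
        rw [Real.exp_lt_one_iff]
        rw [← hsK] at hx
        linarith
      nlinarith
    · have : 1 < exp (-(2 * ε) * (k * (K - -1 * (2 * π * η)))) := by
        rw [Real.one_lt_exp_iff]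
        rw [← hsK] at hx
        linarith
      nlinarith
  have := (Real.exp_pos (-(2 * ε) * (E (θ t) - s * η * θ t))).ne'
  rcases mul_eq_zero.1 hV0 with h | h
  · exact pow_eq_zero_iff (two_ne_zero) |>.1 h
  · exact absurd h this

/-- hyperbolicity -/
lemma scalar_hyp {W w θ θ' : ℝ → ℝ} {η T : ℝ} {k : ℤ} (hW : Continuous W)
    (hp : ∀ θ, W (θ + 2 * π) = W θ) (hT : 0 < T) (hk : 0 < k)
    (hθ : ∀ t, HasDerivAt θ (θ' t) t) (hθc : Continuous θ') (hw : Continuous w)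
    (h : ∀ t, |w t - W (θ t) * θ' t| ≤ η * θ' t)
    (hθT : θ T = θ 0 + k * (2 * π))
    (hη : 2 * π * η < |∫ s in (0:ℝ)..(2 * π), W s|) : ∫ t in (0:ℝ)..T, w t ≠ 0 := by
  set K := ∫ s in (0:ℝ)..(2 * π), W s with hK
  have hθcont : Continuous θ := continuous_iff_continuousAt.2 fun t => (hθ t).continuousAt
  have hk' : (0:ℝ) < k := by exact_mod_cast hk
  have i1 : ∫ t in (0:ℝ)..T, θ' t = k * (2 * π) := by
    rw [intervalIntegral.integral_eq_sub_of_hasDerivAt (fun t _ => hθ t) (hθc.intervalIntegrable _ _),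
      hθT]; ring
  have i2 : ∫ t in (0:ℝ)..T, W (θ t) * θ' t = k * K := by
    have hEd : ∀ t, HasDerivAt (fun t => ∫ u in (0:ℝ)..(θ t), W u) (W (θ t) * θ' t) t := fun t =>
      (intervalIntegral.integral_hasDerivAt_right (hW.intervalIntegrable _ _)
        (hW.stronglyMeasurableAtFilter _ _) hW.continuousAt).comp t (hθ t)
    rw [intervalIntegral.integral_eq_sub_of_hasDerivAt (fun t _ => hEd t)
      (((hW.comp hθcont).mul hθc).intervalIntegrable _ _), hθT, prim_shift hW hp]
    ring
  have cW : Continuous (fun t => W (θ t) * θ' t) := (hW.comp hθcont).mul hθc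
  have i3 : |∫ t in (0:ℝ)..T, (w t - W (θ t) * θ' t)| ≤ ∫ t in (0:ℝ)..T, η * θ' t := by
    refine (intervalIntegral.abs_integral_le_integral_abs hT.le).trans ?_
    refine intervalIntegral.integral_mono_on hT.le ((hw.sub cW).abs.intervalIntegrable _ _)
      ((continuous_const.mul hθc).intervalIntegrable _ _) (fun t _ => h t)
  rw [intervalIntegral.integral_sub (hw.intervalIntegrable _ _) (cW.intervalIntegrable _ _), i2,
    intervalIntegral.integral_const_mul, i1] at i3
  intro h0
  rw [h0, zero_sub, abs_neg, abs_mul, abs_of_pos hk'] at i3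
  nlinarith


/-! ### Existence of periodic solutions of a scalar equation -/

lemma int_close {h P : ℝ → ℝ} {η : ℝ} (hh : ContinuousOn h (Icc 0 (2 * π))) (hP : Continuous P)
    (hc : ∀ θ ∈ Icc 0 (2 * π), |h θ - P θ| ≤ η) :
    |(∫ θ in (0:ℝ)..(2 * π), h θ) - ∫ θ in (0:ℝ)..(2 * π), P θ| ≤ 2 * π * η := by
  have h2 : (0:ℝ) ≤ 2 * π := by positivity
  rw [← intervalIntegral.integral_sub (hh.intervalIntegrable_of_Icc h2) (hP.intervalIntegrable _ _)]
  have := intervalIntegral.norm_integral_le_of_norm_le_const (a := 0) (b := 2 * π) (C := η)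
    (f := fun θ => h θ - P θ) (fun θ hθ => by
      rw [uIoc_of_le h2] at hθ
      exact hc θ ⟨hθ.1.le, hθ.2⟩)
  rw [Real.norm_eq_abs, sub_zero, abs_of_nonneg h2] at this
  linarith

lemma periodize {H : ℝ → ℝ → ℝ} (hHc : Continuous (fun p : ℝ × ℝ => H p.1 p.2))
    (hper : ∀ θ r, H (θ + 2 * π) r = H θ r) {α : ℝ → ℝ}
    (hα : ∀ t ∈ Icc 0 (2 * π), HasDerivWithinAt α (H t (α t)) (Icc 0 (2 * π)) t)
    (hα0 : α (2 * π) = α 0) :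
    ∃ ρ : ℝ → ℝ, (∀ θ, HasDerivAt ρ (H θ (ρ θ)) θ) ∧ (∀ θ, ρ (θ + 2 * π) = ρ θ) ∧
      ∀ θ, ∃ t ∈ Icc 0 (2 * π), ρ θ = α t := by
  have h2 : (0:ℝ) < 2 * π := by positivity
  have : Fact ((0:ℝ) < 2 * π) := ⟨h2⟩
  have hαc : ContinuousOn α (Icc 0 (2 * π)) := fun t ht => (hα t ht).continuousWithinAt
  set β : ℝ → ℝ := fun θ => AddCircle.liftIco (2 * π) 0 α (θ : AddCircle (2 * π)) with hβ
  have hβc : Continuous β :=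
    (AddCircle.liftIco_continuous (by rw [zero_add, hα0]) (by rwa [zero_add])).comp
      (AddCircle.continuous_mk' _)
  have hβp : Function.Periodic β (2 * π) := fun θ => by
    simp only [hβ, AddCircle.coe_add_period]
  have hβI : ∀ t ∈ Ico 0 (2 * π), β t = α t := fun t ht =>
    AddCircle.liftIco_coe_apply (by rwa [zero_add])
  have hβI' : ∀ t ∈ Icc 0 (2 * π), β t = α t := fun t ht => by
    rcases ht.2.eq_or_lt with h | h
    · rw [h, hα0, ← hβI 0 ⟨le_rfl, h2⟩]
      have := hβp 0
      rwa [zero_add] at this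
    · exact hβI t ⟨ht.1, h⟩
  set g : ℝ → ℝ := fun θ => H θ (β θ) with hg
  have hgc : Continuous g := hHc.comp (continuous_id.prodMk hβc)
  have hgp : Function.Periodic g (2 * π) := fun θ => by
    simp only [hg]; rw [hper, hβp]
  set ρ : ℝ → ℝ := fun θ => α 0 + ∫ s in (0:ℝ)..θ, g s with hρ
  have hρd : ∀ θ, HasDerivAt ρ (g θ) θ := fun θ =>
    (intervalIntegral.integral_hasDerivAt_right (hgc.intervalIntegrable _ _)
      (hgc.stronglyMeasurableAtFilter _ _) hgc.continuousAt).const_add _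
  have hρα : ∀ t ∈ Icc 0 (2 * π), ρ t = α t := fun t ht => by
    have : ∫ s in (0:ℝ)..t, g s = α t - α 0 := by
      refine intervalIntegral.integral_eq_sub_of_hasDerivAt_of_le ht.1
        (hαc.mono (Icc_subset_Icc_right ht.2)) (fun s hs => ?_) (hgc.intervalIntegrable _ _)
      have hs' : s ∈ Icc 0 (2 * π) := ⟨hs.1.le, hs.2.le.trans ht.2⟩
      have := (hα s hs').hasDerivAt (Icc_mem_nhds hs.1 (hs.2.trans_le ht.2))
      simp only [hg, hβI' s hs']; exact this
    simp only [hρ, this]; ring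
  have hρp : Function.Periodic ρ (2 * π) := fun θ => by
    have h1 := hgp.intervalIntegral_add_eq_add 0 θ (fun a b => hgc.intervalIntegrable a b)
    rw [zero_add] at h1
    have h3 := hρα (2 * π) ⟨h2.le, le_rfl⟩
    rw [hα0] at h3
    simp only [hρ] at h3 ⊢
    rw [h1]; linarith
  have hρβ : ∀ θ, ρ θ = β θ ∧ ∃ t ∈ Icc 0 (2 * π), ρ θ = α t := fun θ => by
    have hp2 : Function.Periodic (fun θ => (ρ θ, β θ)) (2 * π) := fun θ => by
      simp only [hρp θ, hβp θ]
    obtain ⟨y, hy, he⟩ := hp2.exists_mem_Ico₀ h2 θ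
    have h1 := congrArg Prod.fst he
    have h3 := congrArg Prod.snd he
    simp only at h1 h3
    have hy' : y ∈ Icc 0 (2 * π) := ⟨hy.1, hy.2.le⟩
    exact ⟨by rw [h1, h3, hρα y hy', hβI' y hy'], y, hy', by rw [h1, hρα y hy']⟩
  refine ⟨ρ, fun θ => ?_, hρp, fun θ => (hρβ θ).2⟩
  have := hρd θ
  simp only [hg, ← (hρβ θ).1] at this
  exact this

lemma scalar_exist {H : ℝ → ℝ → ℝ} {C : ℝ} {K : NNReal} {xm xp η s : ℝ} {Pm Pp : ℝ → ℝ}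
    (hHc : Continuous (fun p : ℝ × ℝ => H p.1 p.2)) (hC : ∀ θ r, |H θ r| ≤ C)
    (hK : ∀ θ, LipschitzWith K (H θ)) (hper : ∀ θ r, H (θ + 2 * π) r = H θ r)
    (hx : xm ≤ xp) (hPm : Continuous Pm) (hPp : Continuous Pp) (hs : s = 1 ∨ s = -1)
    (hm : ∀ θ r, |r - xm| ≤ 2 * π * C → |H θ r - Pm θ| ≤ η)
    (hp : ∀ θ r, |r - xp| ≤ 2 * π * C → |H θ r - Pp θ| ≤ η)
    (im : s * (∫ θ in (0:ℝ)..(2 * π), Pm θ) ≤ - (2 * π * η))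
    (ip : 2 * π * η ≤ s * ∫ θ in (0:ℝ)..(2 * π), Pp θ) :
    ∃ ρ : ℝ → ℝ, (∀ θ, HasDerivAt ρ (H θ (ρ θ)) θ) ∧ (∀ θ, ρ (θ + 2 * π) = ρ θ) ∧
      ∃ x ∈ Icc xm xp, ∀ θ, |ρ θ - x| ≤ 2 * π * C := by
  have h2 : (0:ℝ) < 2 * π := by positivity
  have hC0 : 0 ≤ C := (abs_nonneg _).trans (hC 0 0)
  obtain ⟨Ca, hCa⟩ : ∃ z : NNReal, (z : ℝ) = (xp - xm) / 2 + 2 * π * C :=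
    CanLift.prf _ (by have := mul_nonneg h2.le hC0; linarith)
  obtain ⟨Cr, hCr⟩ : ∃ z : NNReal, (z : ℝ) = (xp - xm) / 2 := CanLift.prf _ (by linarith)
  obtain ⟨CC, hCC⟩ : ∃ z : NNReal, (z : ℝ) = C := CanLift.prf _ hC0
  have pl : IsPicardLindelof H (tmin := 0) (tmax := 2 * π) ⟨0, le_rfl, h2.le⟩ ((xm + xp) / 2)
      Ca Cr CC K :=
    { lipschitzOnWith := fun t _ => (hK t).lipschitzOnWith
      continuousOn := fun x _ =>
        (hHc.comp (by fun_prop : Continuous fun t : ℝ => (t, x))).continuousOn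
      norm_le := fun t _ x _ => by rw [hCC]; exact hC t x
      mul_max_le := by
        simp only [sub_zero, sub_self, max_eq_left h2.le, hCa, hCr, hCC]
        linarith }
  obtain ⟨α, hα, L', hL'⟩ := pl.exists_forall_mem_closedBall_eq_hasDerivWithinAt_lipschitzOnWith
  have hball : Metric.closedBall ((xm + xp) / 2) (Cr : ℝ) = Icc xm xp := by
    rw [Real.closedBall_eq_Icc, hCr]; congr 1 <;> ring
  rw [hball] at hα hL'
  have hbd : ∀ x ∈ Icc xm xp, ∀ t ∈ Icc 0 (2 * π), |α x t - x| ≤ 2 * π * C := by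
    intro x hx t ht
    have := (convex_Icc 0 (2 * π)).norm_image_sub_le_of_norm_hasDerivWithin_le (C := C)
      (fun t ht => (hα x hx).2 t ht) (fun t _ => hC t _) ⟨le_rfl, h2.le⟩ ht
    rw [Real.norm_eq_abs, Real.norm_eq_abs, (hα x hx).1, sub_zero, abs_of_nonneg ht.1] at this
    nlinarith [ht.2]
  have hαc : ∀ x ∈ Icc xm xp, ContinuousOn (fun t => H t (α x t)) (Icc 0 (2 * π)) :=
    fun x hx => hHc.comp_continuousOn (continuousOn_id.prodMk
      (fun t ht => ((hα x hx).2 t ht).continuousWithinAt))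
  have hinteg : ∀ x ∈ Icc xm xp, ∫ t in (0:ℝ)..(2 * π), H t (α x t) = α x (2 * π) - x := by
    intro x hx
    rw [intervalIntegral.integral_eq_sub_of_hasDerivAt_of_le h2.le
      (fun t ht => ((hα x hx).2 t ht).continuousWithinAt)
      (fun t ht => ((hα x hx).2 t ⟨ht.1.le, ht.2.le⟩).hasDerivAt (Icc_mem_nhds ht.1 ht.2))
      ((hαc x hx).intervalIntegrable_of_Icc h2.le)]
    rw [(hα x hx).1]
  have mm : xm ∈ Icc xm xp := ⟨le_rfl, hx⟩
  have mp : xp ∈ Icc xm xp := ⟨hx, le_rfl⟩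
  have em := int_close (hαc xm mm) hPm (fun θ hθ => hm θ _ (hbd xm mm θ hθ))
  have ep := int_close (hαc xp mp) hPp (fun θ hθ => hp θ _ (hbd xp mp θ hθ))
  rw [hinteg _ mm] at em
  rw [hinteg _ mp] at ep
  have hcont : ContinuousOn (fun x => s * (α x (2 * π) - x)) (Icc xm xp) :=
    continuousOn_const.mul (((hL' (2 * π) ⟨h2.le, le_rfl⟩).continuousOn).sub continuousOn_id)
  have em' := abs_le.1 em
  have ep' := abs_le.1 ep
  obtain ⟨x, hxI, hx0⟩ : (0:ℝ) ∈ (fun x => s * (α x (2 * π) - x)) '' Icc xm xp := by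
    refine intermediate_value_Icc hx hcont ⟨?_, ?_⟩
    · rcases hs with rfl | rfl <;> linarith [em'.1, em'.2]
    · rcases hs with rfl | rfl <;> linarith [ep'.1, ep'.2]
  have hx1 : α x (2 * π) = α x 0 := by
    have hs0 : s ≠ 0 := by rcases hs with rfl | rfl <;> norm_num
    have := (mul_eq_zero.1 hx0).resolve_left hs0
    have h3 : α x 0 = x := (hα x hxI).1
    linarith
  obtain ⟨ρ, h4, h5, h6⟩ := periodize hHc hper (fun t ht => (hα x hxI).2 t ht) hx1
  refine ⟨ρ, h4, h5, x, hxI, fun θ => ?_⟩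
  obtain ⟨t, ht, he⟩ := h6 θ
  rw [he]; exact hbd x hxI t ht

/-- solving `θ' = h(θ)` -/
lemma solve_time {h : ℝ → ℝ} (hc : Continuous h) (h1 : ∀ x, 1 / 2 ≤ h x) (h2 : ∀ x, h x ≤ 2) :
    ∃ θ : ℝ → ℝ, ∀ t, HasDerivAt θ (h (θ t)) t := by
  have hpos : ∀ x, 0 < h x := fun x => by linarith [h1 x]
  have hic : Continuous (fun x => (h x)⁻¹) := hc.inv₀ (fun x => (hpos x).ne')
  set τ : ℝ → ℝ := fun x => ∫ s in (0:ℝ)..x, (h s)⁻¹ with hτ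
  have hτd : ∀ x, HasDerivAt τ ((h x)⁻¹) x := fun x =>
    intervalIntegral.integral_hasDerivAt_right (hic.intervalIntegrable _ _)
      (hic.stronglyMeasurableAtFilter _ _) hic.continuousAt
  have hsurj : Function.Surjective τ := surj_of_deriv hτd (fun x => by
    rw [one_div]; exact inv_anti₀ (hpos x) (h2 x))
  have hmono : StrictMono τ := strictMono_of_deriv_pos (fun x => by
    rw [(hτd x).deriv]; exact inv_pos.2 (hpos x))
  set e := hmono.orderIsoOfSurjective τ hsurj with he
  refine ⟨e.symm, fun t => ?_⟩
  have hh := HasDerivAt.of_local_left_inverse (f := τ) (g := e.symm) (a := t)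
    e.symm.continuous.continuousAt (hτd _) (inv_ne_zero (hpos _).ne')
    (Eventually.of_forall fun y => e.apply_symm_apply y)
  rwa [inv_inv] at hh


/-! ### The perturbed field -/

/-- the perturbed rotation field -/
def pertField (Y : ℝ × ℝ → ℝ × ℝ) (ε : ℝ) (p : ℝ × ℝ) : ℝ × ℝ := ((-p.2, p.1) : ℝ × ℝ) + ε • Y p

/-- Euclidean radius -/
def eRad (p : ℝ × ℝ) : ℝ := √(p.1 ^ 2 + p.2 ^ 2)

lemma eRad_cont : Continuous eRad := by unfold eRad; fun_prop

lemma eRad_polar {r θ : ℝ} (hr : 0 ≤ r) : eRad (r * cos θ, r * sin θ) = r := by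
  have : (r * cos θ) ^ 2 + (r * sin θ) ^ 2 = r ^ 2 := by
    linear_combination r ^ 2 * sin_sq_add_cos_sq θ
  simp only [eRad, this]
  exact Real.sqrt_sq hr

section pert
variable {Y : ℝ × ℝ → ℝ × ℝ} {ε r₀ δ η : ℝ}

lemma lift_sol (hY : ContDiff ℝ 1 Y) (hδ : δ < r₀) {ψ : ℝ → ℝ × ℝ}
    (hψ : IsSolution (pertField Y ε) ψ) (hr : ∀ t, |eRad (ψ t) - r₀| ≤ δ) :
    ∃ θ : ℝ → ℝ, ∀ t, ψ t = (eRad (ψ t) * cos (θ t), eRad (ψ t) * sin (θ t)) ∧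
      HasDerivAt (fun t => eRad (ψ t)) (ε * polR Y (eRad (ψ t)) (θ t)) t ∧
      HasDerivAt θ (polB Y ε (eRad (ψ t)) (θ t)) t := by
  have hψc : Continuous ψ := continuous_iff_continuousAt.2 fun t => (hψ t).continuousAt
  have hρ : ∀ t, 0 < eRad (ψ t) := fun t => by linarith [(abs_le.1 (hr t)).1]
  have hpos : ∀ t, 0 < (ψ t).1 ^ 2 + (ψ t).2 ^ 2 := fun t => Real.sqrt_pos.1 (hρ t)
  have hYc := hY.continuous
  have hXc : Continuous (fun t => pertField Y ε (ψ t)) := by unfold pertField; fun_prop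
  obtain ⟨θ, hθ⟩ := lift_curve (fun t => hd_fst (hψ t)) (fun t => hd_snd (hψ t)) hXc.fst hXc.snd hpos
  refine ⟨θ, fun t => ?_⟩
  obtain ⟨h1, h2, h3⟩ := hθ t
  change (ψ t).1 = eRad (ψ t) * _ at h1
  change (ψ t).2 = eRad (ψ t) * _ at h2
  have h0 : ψ t = (eRad (ψ t) * cos (θ t), eRad (ψ t) * sin (θ t)) := Prod.ext h1 h2
  have hsq : eRad (ψ t) ^ 2 = (ψ t).1 ^ 2 + (ψ t).2 ^ 2 := Real.sq_sqrt (hpos t).le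
  have hne := (hρ t).ne'
  have hsc := sin_sq_add_cos_sq (θ t)
  refine ⟨h0, ?_, ?_⟩
  · have := (((hd_fst (hψ t)).pow 2).add ((hd_snd (hψ t)).pow 2)).sqrt (hpos t).ne'
    refine this.congr_deriv ?_
    change _ / (2 * eRad (ψ t)) = _
    simp only [polR, ← h0, pertField, Prod.fst_add, Prod.snd_add, Prod.smul_fst, Prod.smul_snd,
      smul_eq_mul]
    rw [div_eq_iff (by positivity)]
    push_cast
    linear_combination 2 * ε * (Y (ψ t)).1 * h1 + 2 * ε * (Y (ψ t)).2 * h2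
  · refine h3.congr_deriv ?_
    rw [← hsq]
    simp only [polB, polS, ← h0, pertField, Prod.fst_add, Prod.snd_add, Prod.smul_fst,
      Prod.smul_snd, smul_eq_mul]
    rw [div_eq_iff (by positivity)]
    field_simp
    linear_combination (-1) * hsq + ε * (Y (ψ t)).2 * h1 - ε * (Y (ψ t)).1 * h2

lemma lift_shift (hδ : δ < r₀) {ψ : ℝ → ℝ × ℝ} {θ : ℝ → ℝ} {T : ℝ}
    (hr : ∀ t, |eRad (ψ t) - r₀| ≤ δ)
    (hB : ∀ r θ, |r - r₀| ≤ δ → 1 / 2 ≤ polB Y ε r θ)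
    (hθ : ∀ t, ψ t = (eRad (ψ t) * cos (θ t), eRad (ψ t) * sin (θ t)) ∧
      HasDerivAt θ (polB Y ε (eRad (ψ t)) (θ t)) t) (hT : 0 < T) (hper : Function.Periodic ψ T) :
    ∃ k : ℤ, 0 < k ∧ ∀ t, θ (t + T) = θ t + k * (2 * π) := by
  have hρ : ∀ t, 0 < eRad (ψ t) := fun t => by linarith [(abs_le.1 (hr t)).1]
  have hcs : ∀ t, cos (θ (t + T)) = cos (θ t) ∧ sin (θ (t + T)) = sin (θ t) := fun t => by
    have h1 := (hθ (t + T)).1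
    rw [hper t, (hθ t).1, eRad_polar (hρ t).le] at h1
    have h2 := congrArg Prod.fst h1
    have h3 := congrArg Prod.snd h1
    simp only at h2 h3
    exact ⟨(mul_left_cancel₀ (hρ t).ne' h2).symm, (mul_left_cancel₀ (hρ t).ne' h3).symm⟩
  have hd : ∀ t, HasDerivAt (fun t => θ (t + T) - θ t) 0 t := fun t => by
    have h1 := ((hθ (t + T)).2.comp_add_const t T).sub (hθ t).2
    refine h1.congr_deriv ?_
    rw [hper t]
    simp [polB, polS, (hcs t).1, (hcs t).2]
  have hconst : ∀ t, θ (t + T) - θ t = θ (0 + T) - θ 0 := fun t =>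
    is_const_of_deriv_eq_zero (fun t => (hd t).differentiableAt) (fun t => (hd t).deriv) t 0
  obtain ⟨k, hk⟩ := Real.Angle.angle_eq_iff_two_pi_dvd_sub.1
    (Real.Angle.cos_sin_inj (hcs 0).1 (hcs 0).2)
  refine ⟨k, ?_, fun t => by linarith [hconst t]⟩
  have hmono : StrictMono θ := strictMono_of_deriv_pos (fun t => by
    rw [(hθ t).2.deriv]; linarith [hB _ (θ t) (hr t)])
  have h4 := hmono (show 0 < 0 + T by linarith)
  have : 0 < 2 * π * (k:ℝ) := by rw [← hk]; linarith
  have h5 : (0:ℝ) < k := by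
    by_contra hcon
    push Not at hcon
    nlinarith [Real.pi_pos]
  exact_mod_cast h5

lemma div_pert (hY : ContDiff ℝ 1 Y) (p : ℝ × ℝ) :
    Divergence (pertField Y ε) p = ε * Divergence Y p := by
  have h1 : HasFDerivAt (fun p : ℝ × ℝ => ((-p.2, p.1) : ℝ × ℝ))
      ((-(ContinuousLinearMap.snd ℝ ℝ ℝ)).prod (ContinuousLinearMap.fst ℝ ℝ ℝ)) p :=
    ((-(ContinuousLinearMap.snd ℝ ℝ ℝ)).prod (ContinuousLinearMap.fst ℝ ℝ ℝ)).hasFDerivAt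
  have h2 := h1.add (((hY.differentiable one_ne_zero) p).hasFDerivAt.const_smul ε)
  have h3 : fderiv ℝ (pertField Y ε) p = _ := h2.fderiv
  simp only [Divergence, h3]
  simp
  ring

lemma cycle_hyp (hY : ContDiff ℝ 1 Y) (hε : 0 < ε) (hδ : δ < r₀) {ψ : ℝ → ℝ × ℝ}
    (hB : ∀ r θ, |r - r₀| ≤ δ → 1 / 2 ≤ polB Y ε r θ)
    (hdiv : ∀ r θ, |r - r₀| ≤ δ → |Divergence Y (r * cos θ, r * sin θ)
        - Divergence Y (r₀ * cos θ, r₀ * sin θ) * polB Y ε r θ| ≤ η * polB Y ε r θ)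
    (hη : 2 * π * η < |∫ θ in (0:ℝ)..(2 * π), Divergence Y (r₀ * cos θ, r₀ * sin θ)|)
    (hψ : IsSolution (pertField Y ε) ψ) (hr : ∀ t, |eRad (ψ t) - r₀| ≤ δ) {T : ℝ} (hT : 0 < T)
    (hper : Function.Periodic ψ T) : ∫ t in (0:ℝ)..T, Divergence (pertField Y ε) (ψ t) ≠ 0 := by
  have hψc : Continuous ψ := continuous_iff_continuousAt.2 fun t => (hψ t).continuousAt
  have hρ : ∀ t, 0 < eRad (ψ t) := fun t => by linarith [(abs_le.1 (hr t)).1]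
  obtain ⟨θ, hθ⟩ := lift_sol hY hδ hψ hr
  obtain ⟨k, hk, hkT⟩ := lift_shift hδ hr hB (fun t => ⟨(hθ t).1, (hθ t).2.2⟩) hT hper
  have hθc : Continuous θ := continuous_iff_continuousAt.2 fun t => (hθ t).2.2.continuousAt
  have hec : Continuous (fun t => eRad (ψ t)) := eRad_cont.comp hψc
  have hdc := div_cont hY
  have hBc : Continuous (fun t => polB Y ε (eRad (ψ t)) (θ t)) := by
    refine continuous_iff_continuousAt.2 fun t => ?_
    have h1 := polB_cont hY (ε, eRad (ψ t)) (hρ t).ne' (θ t)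
    exact ContinuousAt.comp (f := fun t => ((ε, eRad (ψ t)), θ t)) (x := t) h1
      (by fun_prop : Continuous fun t => ((ε, eRad (ψ t)), θ t)).continuousAt
  have := scalar_hyp (W := fun θ => Divergence Y (r₀ * cos θ, r₀ * sin θ))
    (w := fun t => Divergence Y (ψ t)) (η := η) (by fun_prop) (fun θ => by simp) hT hk
    (fun t => (hθ t).2.2) hBc (hdc.comp hψc) (fun t => by
      have := hdiv _ (θ t) (hr t)
      rwa [← (hθ t).1] at this) (by have := hkT 0; rwa [zero_add] at this) hη
  simp only [div_pert hY, intervalIntegral.integral_const_mul]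
  exact mul_ne_zero hε.ne' this

lemma cycle_unique (hY : ContDiff ℝ 1 Y) (hε : 0 < ε) (hδ : δ < r₀) {ψ : ℝ → ℝ × ℝ}
    (hB : ∀ r θ, |r - r₀| ≤ δ → 1 / 2 ≤ polB Y ε r θ)
    (hlin : ∀ r r' θ, |r - r₀| ≤ δ → |r' - r₀| ≤ δ →
      |polG Y ε r θ - polG Y ε r' θ - polRr Y r₀ θ * (r - r')| ≤ η * |r - r'|)
    (hη : 2 * π * η < |∫ θ in (0:ℝ)..(2 * π), polRr Y r₀ θ|) {ρ : ℝ → ℝ}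
    (hρd : ∀ θ, HasDerivAt ρ (ε * polG Y ε (ρ θ) θ) θ) (hρp : ∀ θ, ρ (θ + 2 * π) = ρ θ)
    (hρδ : ∀ θ, |ρ θ - r₀| ≤ δ)
    (hψ : IsSolution (pertField Y ε) ψ) (hr : ∀ t, |eRad (ψ t) - r₀| ≤ δ) {T : ℝ} (hT : 0 < T)
    (hper : Function.Periodic ψ T) :
    Set.range ψ = Set.range (fun θ => (ρ θ * cos θ, ρ θ * sin θ)) := by
  obtain ⟨θ, hθ⟩ := lift_sol hY hδ hψ hr
  obtain ⟨k, hk, hkT⟩ := lift_shift hδ hr hB (fun t => ⟨(hθ t).1, (hθ t).2.2⟩) hT hper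
  have hρp' : Function.Periodic ρ (2 * π) := hρp
  have key : ∀ t, eRad (ψ t) - ρ (θ t) = 0 := by
    refine scalar_unique (D := fun θ => polRr Y r₀ θ) (θ := θ) (η := η) (k := k)
      (γ := fun t => polG Y ε (eRad (ψ t)) (θ t) - polG Y ε (ρ (θ t)) (θ t))
      ((polRr_cont hY).comp (by fun_prop : Continuous fun θ : ℝ => (r₀, θ)))
      (fun θ => polRr_per _ _) hε hT hk (fun t => ?_) (fun t => (hθ t).2.2)
      (fun t => by linarith [hB _ (θ t) (hr t)]) (fun t => hlin _ _ _ (hr t) (hρδ _))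
      (fun t => ?_) hkT hη
    · have h1 := (hθ t).2.1.sub ((hρd (θ t)).comp t (hθ t).2.2)
      refine h1.congr_deriv ?_
      have hb : polB Y ε (eRad (ψ t)) (θ t) ≠ 0 := by linarith [hB _ (θ t) (hr t)]
      have : polR Y (eRad (ψ t)) (θ t) =
          polG Y ε (eRad (ψ t)) (θ t) * polB Y ε (eRad (ψ t)) (θ t) := by
        rw [polG, div_mul_cancel₀ _ hb]
      rw [this]; ring
    · rw [hper t, hkT t]
      have := hρp'.int_mul k (θ t)
      rw [this]
  have key' : ∀ t, ψ t = (ρ (θ t) * cos (θ t), ρ (θ t) * sin (θ t)) := fun t => by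
    have h1 := (hθ t).1
    rwa [sub_eq_zero.1 (key t)] at h1
  have hsurj : Function.Surjective θ := surj_of_deriv (fun t => (hθ t).2.2)
    (fun t => hB _ _ (hr t))
  apply Set.Subset.antisymm
  · rintro _ ⟨t, rfl⟩; exact ⟨θ t, (key' t).symm⟩
  · rintro _ ⟨s, rfl⟩
    obtain ⟨t, rfl⟩ := hsurj s
    exact ⟨t, key' t⟩

lemma cycle_exists (hY : ContDiff ℝ 1 Y) (hδ : δ < r₀)
    (hB : ∀ r θ, |r - r₀| ≤ δ → 1 / 2 ≤ polB Y ε r θ ∧ polB Y ε r θ ≤ 2) {ρ : ℝ → ℝ}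
    (hρd : ∀ θ, HasDerivAt ρ (ε * polG Y ε (ρ θ) θ) θ) (hρp : ∀ θ, ρ (θ + 2 * π) = ρ θ)
    (hρδ : ∀ θ, |ρ θ - r₀| ≤ δ) :
    ∃ φ : ℝ → ℝ × ℝ, IsPeriodicOrbit (pertField Y ε) φ ∧
      ∀ t, ∃ θ, φ t = (ρ θ * cos θ, ρ θ * sin θ) := by
  have hpos : ∀ θ, 0 < ρ θ := fun t => by linarith [(abs_le.1 (hρδ t)).1]
  have hρc : Continuous ρ := continuous_iff_continuousAt.2 fun t => (hρd t).continuousAt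
  set h : ℝ → ℝ := fun θ => polB Y ε (ρ θ) θ with hh
  have hc : Continuous h := by
    refine continuous_iff_continuousAt.2 fun t => ?_
    have h1 := polB_cont hY (ε, ρ t) (hpos t).ne' t
    exact ContinuousAt.comp (f := fun t => ((ε, ρ t), t)) (x := t) h1
      (by fun_prop : Continuous fun t => ((ε, ρ t), t)).continuousAt
  have hper : ∀ θ, h (θ + 2 * π) = h θ := fun θ => by
    simp only [hh, hρp, polB_per]
  obtain ⟨Θ, hΘ⟩ := solve_time hc (fun x => (hB _ _ (hρδ x)).1) (fun x => (hB _ _ (hρδ x)).2)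
  have hsurj : Function.Surjective Θ := surj_of_deriv hΘ (fun t => (hB _ _ (hρδ _)).1)
  have hhpos : ∀ x, 0 < h x := fun x => by linarith [(hB _ x (hρδ x)).1]
  have hic : Continuous (fun x => (h x)⁻¹) := hc.inv₀ (fun x => (hhpos x).ne')
  set τ : ℝ → ℝ := fun x => ∫ s in (0:ℝ)..x, (h s)⁻¹ with hτ
  have hτd : ∀ x, HasDerivAt τ ((h x)⁻¹) x := fun x =>
    intervalIntegral.integral_hasDerivAt_right (hic.intervalIntegrable _ _)
      (hic.stronglyMeasurableAtFilter _ _) hic.continuousAt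
  have hτmono : StrictMono τ := strictMono_of_deriv_pos (fun x => by
    rw [(hτd x).deriv]; exact inv_pos.2 (hhpos x))
  have hτΘ : ∀ t, τ (Θ t) = τ (Θ 0) + t := fun t => by
    have hd : ∀ t, HasDerivAt (fun t => τ (Θ t) - t) 0 t := fun t => by
      have := ((hτd (Θ t)).comp t (hΘ t)).sub (hasDerivAt_id t)
      refine this.congr_deriv ?_
      rw [inv_mul_cancel₀ (hhpos _).ne', sub_self]
    have := is_const_of_deriv_eq_zero (fun t => (hd t).differentiableAt) (fun t => (hd t).deriv) t 0
    linarith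
  set T : ℝ := ∫ s in (0:ℝ)..(2 * π), (h s)⁻¹ with hT
  have hτshift : ∀ x, τ (x + 2 * π) = τ x + T := fun x => by
    have := prim_shift hic (fun θ => by rw [hper]) x 1
    simpa using this
  have hTpos : 0 < T := by
    have h1 := hτmono (show (0:ℝ) < 0 + 2 * π by linarith [Real.pi_pos])
    rw [hτshift] at h1; linarith
  have hΘT : ∀ t, Θ (t + T) = Θ t + 2 * π := fun t => by
    apply hτmono.injective
    rw [hτshift, hτΘ, hτΘ t]; ring
  refine ⟨fun t => (ρ (Θ t) * cos (Θ t), ρ (Θ t) * sin (Θ t)), ⟨fun t => ?_, ⟨T, hTpos, fun t => ?_⟩, ?_⟩,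
    fun t => ⟨Θ t, rfl⟩⟩
  · have h1 : HasDerivAt (fun t => ρ (Θ t)) (ε * polG Y ε (ρ (Θ t)) (Θ t) * h (Θ t)) t :=
      (hρd (Θ t)).comp t (hΘ t)
    have h2 := (h1.mul (hΘ t).cos).prodMk (h1.mul (hΘ t).sin)
    refine h2.congr_deriv ?_
    have hG : polG Y ε (ρ (Θ t)) (Θ t) * h (Θ t) = polR Y (ρ (Θ t)) (Θ t) :=
      div_mul_cancel₀ _ (hhpos _).ne'
    have hS : ρ (Θ t) * h (Θ t) = ρ (Θ t) + ε * polS Y (ρ (Θ t)) (Θ t) := by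
      have := (hpos (Θ t)).ne'
      simp only [hh, polB]
      field_simp
    rw [mul_assoc ε, hG]
    have hsc := sin_sq_add_cos_sq (Θ t)
    apply Prod.ext
    · simp only [pertField, Prod.fst_add, Prod.smul_fst, smul_eq_mul]
      simp only [polR, polS] at hS ⊢
      linear_combination (-sin (Θ t)) * hS
        + ε * (Y (ρ (Θ t) * cos (Θ t), ρ (Θ t) * sin (Θ t))).1 * hsc
    · simp only [pertField, Prod.snd_add, Prod.smul_snd, smul_eq_mul]
      simp only [polR, polS] at hS ⊢
      linear_combination (cos (Θ t)) * hS
        + ε * (Y (ρ (Θ t) * cos (Θ t), ρ (Θ t) * sin (Θ t))).2 * hsc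
  · simp only [hΘT, hρp, cos_add_two_pi, sin_add_two_pi]
  · rintro ⟨c, hcc⟩
    obtain ⟨t1, h1⟩ := hsurj 0
    obtain ⟨t2, h2⟩ := hsurj π
    have e := (hcc t1).trans (hcc t2).symm
    have := congrArg Prod.fst e
    simp only [h1, h2, cos_zero, cos_pi] at this
    linarith [hpos 0, hpos π]

end pert

section mainCycle
variable {Y : ℝ × ℝ → ℝ × ℝ}

lemma bdd_angle {f : ℝ → ℝ} (hf : Continuous f) (hp : Function.Periodic f (2 * π)) :
    ∃ C, 0 ≤ C ∧ ∀ θ, |f θ| ≤ C := by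
  obtain ⟨C, hC⟩ := (isCompact_Icc (a := (0:ℝ)) (b := 2 * π)).exists_bound_of_continuousOn
    hf.continuousOn
  refine ⟨C, (norm_nonneg _).trans (hC 0 ⟨le_rfl, by positivity⟩), fun θ => ?_⟩
  obtain ⟨y, hy, hy2⟩ := hp.exists_mem_Ico₀ (by positivity) θ
  rw [hy2]
  exact hC y ⟨hy.1, hy.2.le⟩

lemma box_lin (hY : ContDiff ℝ 1 Y) {ε r₀ η δ : ℝ} (hδ : δ < r₀)
    (hB : ∀ r θ, |r - r₀| ≤ δ → 1 / 2 ≤ polB Y ε r θ)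
    (hG : ∀ r θ, |r - r₀| ≤ δ → |polGr Y ε r θ - polRr Y r₀ θ| ≤ η)
    (r r' θ : ℝ) (hr : |r - r₀| ≤ δ) (hr' : |r' - r₀| ≤ δ) :
    |polG Y ε r θ - polG Y ε r' θ - polRr Y r₀ θ * (r - r')| ≤ η * |r - r'| := by
  have key := Convex.norm_image_sub_le_of_norm_hasDerivWithin_le
    (f := fun r => polG Y ε r θ - polRr Y r₀ θ * r)
    (f' := fun r => polGr Y ε r θ - polRr Y r₀ θ * 1) (s := Metric.closedBall r₀ δ) (C := η)
    (x := r') (y := r) (fun x hx => ?_) (fun x hx => ?_) (convex_closedBall _ _) ?_ ?_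
  · simp only [Real.norm_eq_abs] at key
    convert key using 2
    ring
  · rw [Metric.mem_closedBall, Real.dist_eq] at hx
    have hx0 : x ≠ 0 := by
      have := (abs_le.1 hx).1
      intro h; rw [h] at this; linarith
    have hb : polB Y ε x θ ≠ 0 := by
      have := hB x θ hx
      intro h; rw [h] at this; norm_num at this
    exact ((polG_hasDeriv hY ε x θ hx0 hb).sub
      ((hasDerivAt_id x).const_mul (polRr Y r₀ θ))).hasDerivWithinAt
  · rw [Metric.mem_closedBall, Real.dist_eq] at hx
    rw [mul_one]; exact hG x θ hx
  · rwa [Metric.mem_closedBall, Real.dist_eq]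
  · rwa [Metric.mem_closedBall, Real.dist_eq]

lemma polG_near (hY : ContDiff ℝ 1 Y) {x κ : ℝ} (hx : 0 < x) (hκ : 0 < κ) :
    ∃ d > 0, ∀ ε r θ, |ε| < d → |r - x| < d → |polG Y ε r θ - polR Y x θ| ≤ κ := by
  have h := unif_angle (F := fun q θ => polG Y q.1 q.2 θ) (0, x)
    (fun θ => polG_cont hY (0, x) hx.ne' θ (by rw [polB_zero]; exact one_ne_zero))
    (fun q θ => by simp [polG, polR, polB, polS]) hκ
  rw [Metric.eventually_nhds_iff] at h
  obtain ⟨d, hd, h⟩ := h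
  refine ⟨d, hd, fun ε r θ h1 h2 => ?_⟩
  have := h (y := (ε, r)) (by
    rw [Prod.dist_eq, max_lt_iff]
    simp only [Real.dist_eq, sub_zero]; exact ⟨h1, h2⟩) θ
  rw [polG_zero] at this
  exact this.le

lemma int_polR_near (hY : ContDiff ℝ 1 Y) {r₀ η δ : ℝ}
    (hlin : ∀ r θ, |r - r₀| ≤ δ →
      |polR Y r θ - polR Y r₀ θ - polRr Y r₀ θ * (r - r₀)| ≤ η * |r - r₀|)
    (h0 : ∫ θ in (0:ℝ)..(2 * π), polR Y r₀ θ = 0) (r : ℝ) (hr : |r - r₀| ≤ δ) :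
    |(∫ θ in (0:ℝ)..(2 * π), polR Y r θ) - (∫ θ in (0:ℝ)..(2 * π), polRr Y r₀ θ) * (r - r₀)|
      ≤ 2 * π * (η * |r - r₀|) := by
  have c1 : ∀ r, Continuous (fun θ => polR Y r θ) := fun r =>
    (polR_cont hY).comp (by fun_prop : Continuous fun θ : ℝ => (r, θ))
  have c2 : Continuous (fun θ => polRr Y r₀ θ) :=
    (polRr_cont hY).comp (by fun_prop : Continuous fun θ : ℝ => (r₀, θ))
  have := int_close (h := fun θ => polR Y r θ)
    (P := fun θ => polR Y r₀ θ + polRr Y r₀ θ * (r - r₀)) (η := η * |r - r₀|)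
    (c1 r).continuousOn ((c1 r₀).add (c2.mul continuous_const)) (fun θ _ => by
      have := hlin r θ hr
      rwa [sub_sub] at this)
  have c3 : Continuous (fun θ => polRr Y r₀ θ * (r - r₀)) := c2.mul continuous_const
  rw [intervalIntegral.integral_add ((c1 r₀).intervalIntegrable _ _)
    (c3.intervalIntegrable _ _), h0, zero_add,
    intervalIntegral.integral_mul_const] at this
  exact this

lemma main_cycle (hY : ContDiff ℝ 1 Y) {r₀ δ : ℝ} (hr₀ : 0 < r₀) (hδ : 0 < δ)
    (h0 : ∫ θ in (0:ℝ)..(2 * π), polR Y r₀ θ = 0)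
    (hK : ∫ θ in (0:ℝ)..(2 * π), polRr Y r₀ θ ≠ 0) :
    ∀ᶠ ε in 𝓝[>] (0:ℝ), ∃ φ, IsHyperbolicLimitCycle (pertField Y ε) φ ∧
      ∀ t, |eRad (φ t) - r₀| < δ := by
  have hπ := Real.pi_pos
  set K := ∫ θ in (0:ℝ)..(2 * π), polRr Y r₀ θ with hKdef
  have hKpos : 0 < |K| := abs_pos.2 hK
  set η := |K| / (8 * π) with hη
  have hηpos : 0 < η := by positivity
  have hη2 : 2 * π * η = |K| / 4 := by rw [hη]; field_simp; norm_num
  obtain ⟨δ₀, hδ₀, hδr, hbox⟩ := good_box hY hr₀ hηpos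
  set d' := min δ₀ (δ / 2) with hd'
  have hd'pos : 0 < d' := lt_min hδ₀ (by linarith)
  have hd'0 : d' ≤ δ₀ := min_le_left _ _
  have hd'1 : d' < δ := (min_le_right _ _).trans_lt (by linarith)
  have hd'r : d' < r₀ := hd'0.trans_lt hδr
  have c1 : ∀ r, Continuous (fun θ => polR Y r θ) := fun r =>
    (polR_cont hY).comp (by fun_prop : Continuous fun θ : ℝ => (r, θ))
  have c2 : Continuous (fun θ => polRr Y r₀ θ) :=
    (polRr_cont hY).comp (by fun_prop : Continuous fun θ : ℝ => (r₀, θ))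
  obtain ⟨C0, hC0, hC0b⟩ := bdd_angle (c1 r₀) (fun θ => by simp [polR])
  obtain ⟨C1, hC1, hC1b⟩ := bdd_angle c2 (fun θ => by simp [polRr])
  have hlin : ∀ ε, |ε| ≤ δ₀ → ∀ r r' θ, |r - r₀| ≤ d' → |r' - r₀| ≤ d' →
      |polG Y ε r θ - polG Y ε r' θ - polRr Y r₀ θ * (r - r')| ≤ η * |r - r'| := fun ε hε =>
    box_lin hY hd'r (fun r θ h => (hbox ε r θ hε (h.trans hd'0)).1.1)
      (fun r θ h => (hbox ε r θ hε (h.trans hd'0)).2.1)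
  have hr0d : |r₀ - r₀| ≤ d' := by simp [hd'pos.le]
  have hnear := int_polR_near hY (δ := d') (η := η) (r₀ := r₀) (fun r θ h => by
    have := hlin 0 (by simp [hδ₀.le]) r r₀ θ h hr0d
    rwa [polG_zero, polG_zero] at this) h0
  set xm := r₀ - d' / 2 with hxm
  set xp := r₀ + d' / 2 with hxp
  have axp : |xp - r₀| = d' / 2 := by rw [hxp, add_sub_cancel_left, abs_of_pos (by linarith)]
  have axm : |xm - r₀| = d' / 2 := by
    rw [hxm, sub_sub_cancel_left, abs_neg, abs_of_pos (by linarith)]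
  have hnp := hnear xp (by rw [axp]; linarith)
  have hnm := hnear xm (by rw [axm]; linarith)
  rw [axp, ← mul_assoc, hη2, ← hKdef, hxp, add_sub_cancel_left, ← hxp] at hnp
  rw [axm, ← mul_assoc, hη2, ← hKdef, hxm, sub_sub_cancel_left, ← hxm] at hnm
  obtain ⟨s, hs, hsK⟩ : ∃ s : ℝ, (s = 1 ∨ s = -1) ∧ |K| = s * K := by
    rcases abs_choice K with h | h
    · exact ⟨1, Or.inl rfl, by rw [h, one_mul]⟩
    · exact ⟨-1, Or.inr rfl, by rw [h]; ring⟩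
  set κ := |K| * d' / (16 * π) with hκ
  have hκpos : 0 < κ := by positivity
  have hκ2 : 2 * π * κ = |K| * d' / 8 := by rw [hκ]; field_simp; norm_num
  have ip0 : 2 * π * κ ≤ s * ∫ θ in (0:ℝ)..(2 * π), polR Y xp θ := by
    rw [hκ2]
    have h1 := abs_le.1 hnp
    have : 0 < |K| * d' := by positivity
    rcases hs with h | h <;> subst h <;> rw [hsK] at h1 this ⊢ <;> nlinarith [h1.1, h1.2]
  have im0 : s * (∫ θ in (0:ℝ)..(2 * π), polR Y xm θ) ≤ -(2 * π * κ) := by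
    rw [hκ2]
    have h1 := abs_le.1 hnm
    have : 0 < |K| * d' := by positivity
    rcases hs with h | h <;> subst h <;> rw [hsK] at h1 this ⊢ <;> nlinarith [h1.1, h1.2]
  obtain ⟨dp, hdp, hGp⟩ := polG_near hY (x := xp) (by linarith) hκpos
  obtain ⟨dm, hdm, hGm⟩ := polG_near hY (x := xm) (by linarith) hκpos
  have ev1 : ∀ᶠ ε in 𝓝[>] (0:ℝ), 0 < ε := eventually_mem_nhdsWithin
  have ev : ∀ c > 0, ∀ᶠ ε in 𝓝[>] (0:ℝ), ε < c := fun c hc =>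
    (eventually_lt_nhds hc).filter_mono nhdsWithin_le_nhds
  have hC : 0 < 2 * π * (C0 + 1) := by positivity
  have ev' : ∀ c > 0, ∀ᶠ ε in 𝓝[>] (0:ℝ), 2 * π * (ε * (C0 + 1)) < c := fun c hc => by
    filter_upwards [ev (c / (2 * π * (C0 + 1))) (by positivity)] with ε h
    rw [lt_div_iff₀ hC] at h
    linarith
  filter_upwards [ev1, ev δ₀ hδ₀, ev dp hdp, ev dm hdm, ev' dp hdp, ev' dm hdm,
    ev' (d' / 2) (by linarith)] with ε hε e0 ep em ep' em' e2
  have hεa : |ε| = ε := abs_of_pos hε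
  have hε0 : |ε| ≤ δ₀ := by rw [hεa]; exact e0.le
  set cl : ℝ → ℝ := fun r => max (r₀ - d') (min (r₀ + d') r) with hcl
  have hclc : Continuous cl := by rw [hcl]; fun_prop
  have hclm : ∀ r, |cl r - r₀| ≤ d' := fun r => by
    rw [abs_le]
    have h1 := le_max_left (r₀ - d') (min (r₀ + d') r)
    have h2 : cl r ≤ r₀ + d' := max_le (by linarith) (min_le_left _ _)
    constructor
    · simp only [hcl]; linarith
    · linarith
  have hclid : ∀ r, |r - r₀| ≤ d' → cl r = r := fun r h => by
    have := abs_le.1 h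
    simp only [hcl]
    rw [min_eq_right (by linarith), max_eq_right (by linarith)]
  have hcllip : ∀ r r', |cl r - cl r'| ≤ |r - r'| := fun r r' => by
    have h1 := abs_max_sub_max_le_max (r₀ - d') (min (r₀ + d') r) (r₀ - d') (min (r₀ + d') r')
    have h2 := abs_min_sub_min_le_max (r₀ + d') r (r₀ + d') r'
    simp only [sub_self, abs_zero] at h1 h2
    exact h1.trans (max_le (abs_nonneg _) (h2.trans (max_le (abs_nonneg _) le_rfl)))
  have hclpos : ∀ r, 0 < cl r := fun r => by linarith [(abs_le.1 (hclm r)).1]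
  have hBx : ∀ r θ, |r - r₀| ≤ d' → 1 / 2 ≤ polB Y ε r θ ∧ polB Y ε r θ ≤ 2 := fun r θ h =>
    (hbox ε r θ hε0 (h.trans hd'0)).1
  have hBne : ∀ r θ, polB Y ε (cl r) θ ≠ 0 := fun r θ h => by
    have := (hBx _ θ (hclm r)).1
    rw [h] at this; norm_num at this
  have hclnear : ∀ r x, |x - r₀| ≤ d' → |cl r - x| ≤ |r - x| := fun r x hx => by
    have := hcllip r x
    rwa [hclid x hx] at this
  obtain ⟨ρ, hρd, hρp, x, hx, hρx⟩ := scalar_exist (H := fun θ r => ε * polG Y ε (cl r) θ)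
    (C := ε * (C0 + 1)) (K := (ε * (C1 + η)).toNNReal) (xm := xm) (xp := xp) (η := ε * κ) (s := s)
    (Pm := fun θ => ε * polR Y xm θ) (Pp := fun θ => ε * polR Y xp θ)
    (by
      refine continuous_iff_continuousAt.2 fun p => ?_
      have h1 := polG_cont hY (ε, cl p.2) (hclpos _).ne' p.1 (hBne _ _)
      have h2 : ContinuousAt (fun p : ℝ × ℝ => ((ε, cl p.2), p.1)) p := by fun_prop
      exact (ContinuousAt.comp (f := fun p : ℝ × ℝ => ((ε, cl p.2), p.1)) (x := p) h1 h2).const_mul ε)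
    (fun θ r => by
      rw [abs_mul, hεa]
      have h1 := (hbox ε (cl r) θ hε0 ((hclm r).trans hd'0)).2.2.2
      have h2 := hC0b θ
      have h3 := abs_sub_abs_le_abs_sub (polG Y ε (cl r) θ) (polR Y r₀ θ)
      exact mul_le_mul_of_nonneg_left (by linarith) hε.le)
    (fun θ => LipschitzWith.of_dist_le_mul fun r r' => by
      rw [Real.dist_eq, Real.dist_eq, Real.coe_toNNReal _ (by positivity), ← mul_sub, abs_mul, hεa,
        mul_assoc]
      refine mul_le_mul_of_nonneg_left ?_ hε.le
      have h1 := hlin ε hε0 (cl r) (cl r') θ (hclm _) (hclm _)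
      have h2 := abs_sub_abs_le_abs_sub (polG Y ε (cl r) θ - polG Y ε (cl r') θ)
        (polRr Y r₀ θ * (cl r - cl r'))
      have h3 : |polRr Y r₀ θ * (cl r - cl r')| ≤ C1 * |cl r - cl r'| := by
        rw [abs_mul]; exact mul_le_mul_of_nonneg_right (hC1b θ) (abs_nonneg _)
      have h4 : (C1 + η) * |cl r - cl r'| ≤ (C1 + η) * |r - r'| :=
        mul_le_mul_of_nonneg_left (hcllip r r') (by positivity)
      linarith)
    (fun θ r => by simp [polG, polR, polB, polS])
    (by linarith) ((c1 xm).const_mul ε) ((c1 xp).const_mul ε) hs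
    (fun θ r h => by
      rw [← mul_sub, abs_mul, hεa]
      refine mul_le_mul_of_nonneg_left (hGm _ _ _ (by rwa [hεa]) ?_) hε.le
      exact ((hclnear r xm (by rw [axm]; linarith)).trans h).trans_lt em')
    (fun θ r h => by
      rw [← mul_sub, abs_mul, hεa]
      refine mul_le_mul_of_nonneg_left (hGp _ _ _ (by rwa [hεa]) ?_) hε.le
      exact ((hclnear r xp (by rw [axp]; linarith)).trans h).trans_lt ep')
    (by
      rw [intervalIntegral.integral_const_mul]
      have := mul_le_mul_of_nonneg_left im0 hε.le
      linarith)
    (by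
      rw [intervalIntegral.integral_const_mul]
      have := mul_le_mul_of_nonneg_left ip0 hε.le
      linarith)
  have hρs : ∀ θ, |ρ θ - r₀| < d' := fun θ => by
    have h1 := abs_le.1 (hρx θ)
    obtain ⟨h2, h3⟩ := hx
    rw [abs_lt]; constructor <;> linarith
  have hρd' : ∀ θ, HasDerivAt ρ (ε * polG Y ε (ρ θ) θ) θ := fun θ => by
    have := hρd θ
    simp only [hclid _ (hρs θ).le] at this
    exact this
  obtain ⟨φ, hφ, hφρ⟩ := cycle_exists hY hd'r hBx hρd' hρp (fun θ => (hρs θ).le)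
  have hφr : ∀ t, |eRad (φ t) - r₀| < d' := fun t => by
    obtain ⟨θ, hθ⟩ := hφρ t
    rw [hθ, eRad_polar (by linarith [(abs_lt.1 (hρs θ)).1])]
    exact hρs θ
  have huniq : ∀ ψ, IsPeriodicOrbit (pertField Y ε) ψ → (∀ t, |eRad (ψ t) - r₀| < d') →
      Set.range ψ = Set.range (fun θ => (ρ θ * cos θ, ρ θ * sin θ)) := fun ψ hψ hr => by
    obtain ⟨h1, ⟨T, hT, hper⟩, _⟩ := hψ
    exact cycle_unique hY hε hd'r (fun r θ h => (hBx r θ h).1) (hlin ε hε0)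
      (by rw [hη2, ← hKdef]; linarith) hρd' hρp (fun θ => (hρs θ).le) h1 (fun t => (hr t).le) hT hper
  refine ⟨φ, ⟨⟨hφ, {p | |eRad p - r₀| < d'}, ?_, ?_, ?_⟩, ?_⟩, fun t => (hφr t).trans hd'1⟩
  · exact isOpen_lt (by have := eRad_cont; fun_prop) continuous_const
  · rintro _ ⟨t, rfl⟩; exact hφr t
  · intro ψ hψ hU
    rw [huniq ψ hψ (fun t => hU ⟨t, rfl⟩), huniq φ hφ hφr]
  · intro T hT hper
    exact cycle_hyp hY hε hd'r (fun r θ h => (hBx r θ h).1)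
      (fun r θ h => (hbox ε r θ hε0 (h.trans hd'0)).2.2.1)
      (by rw [integral_div hY r₀ hr₀ h0, ← hKdef, hη2]; linarith) hφ.1 (fun t => (hφr t).le) hT hper

end mainCycle

section expSums

lemma expSum_rolle (S : Finset ℝ) (c : ℝ → ℝ) (a : ℝ) (T s : Finset ℝ)
    (hT : ∀ t, ∑ k ∈ S, c k * (k - a) * exp (k * t) = 0 → t ∈ T)
    (hs : ∀ t ∈ s, ∑ k ∈ S, c k * exp (k * t) = 0) : s.card ≤ (T \ s).card + 1 := by
  refine Finset.card_le_sdiff_of_interleaved fun x hx y hy hxy _ => ?_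
  have hd : ∀ t, HasDerivAt (fun t => ∑ k ∈ S, c k * exp ((k - a) * t))
      (∑ k ∈ S, c k * (exp ((k - a) * t) * ((k - a) * 1))) t := fun t =>
    HasDerivAt.fun_sum fun k _ => (((hasDerivAt_id t).const_mul (k - a)).exp).const_mul (c k)
  have he : ∀ t k, exp ((k - a) * t) = exp (-(a * t)) * exp (k * t) := fun t k => by
    rw [← Real.exp_add]; congr 1; ring
  have hz : ∀ t, ∑ k ∈ S, c k * exp (k * t) = 0 → ∑ k ∈ S, c k * exp ((k - a) * t) = 0 :=
    fun t ht => by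
      have : ∑ k ∈ S, c k * exp ((k - a) * t) = exp (-(a * t)) * ∑ k ∈ S, c k * exp (k * t) := by
        rw [Finset.mul_sum]
        exact Finset.sum_congr rfl fun k _ => by rw [he]; ring
      rw [this, ht, mul_zero]
  obtain ⟨z, hz1, hz2⟩ := exists_hasDerivAt_eq_zero hxy
    (continuous_iff_continuousAt.2 fun t => (hd t).continuousAt).continuousOn
    (by rw [hz x (hs x hx), hz y (hs y hy)]) (fun t _ => hd t)
  refine ⟨z, hT z ?_, hz1.1, hz1.2⟩
  have : ∑ k ∈ S, c k * (exp ((k - a) * z) * ((k - a) * 1))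
      = exp (-(a * z)) * ∑ k ∈ S, c k * (k - a) * exp (k * z) := by
    rw [Finset.mul_sum]
    exact Finset.sum_congr rfl fun k _ => by rw [he]; ring
  rw [this] at hz2
  exact (mul_eq_zero.1 hz2).resolve_left (Real.exp_pos _).ne'

lemma expSum_zeros (S : Finset ℝ) : ∀ c : ℝ → ℝ, (∃ k ∈ S, c k ≠ 0) →
    ∃ T : Finset ℝ, (∀ t, ∑ k ∈ S, c k * exp (k * t) = 0 ↔ t ∈ T) ∧ T.card + 1 ≤ S.card := by
  induction S using Finset.induction_on with
  | empty => rintro c ⟨k, hk, _⟩; simp at hk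
  | insert a S ha ih =>
    intro c hc
    by_cases h : ∃ k ∈ S, c k ≠ 0
    · obtain ⟨k, hk, hck⟩ := h
      have hka : k - a ≠ 0 := sub_ne_zero.2 (fun h => ha (h ▸ hk))
      obtain ⟨T', hT', hc'⟩ := ih (fun k => c k * (k - a)) ⟨k, hk, mul_ne_zero hck hka⟩
      have hb : ∀ s : Finset ℝ, (∀ t ∈ s, ∑ k ∈ insert a S, c k * exp (k * t) = 0) →
          s.card ≤ S.card := fun s hs => by
        have h1 := expSum_rolle (insert a S) c a T' s (fun t ht => by
          rw [Finset.sum_insert ha, sub_self, mul_zero, zero_mul, zero_add] at ht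
          exact (hT' t).1 ht) hs
        have h2 := Finset.card_le_card (Finset.sdiff_subset (s := T') (t := s))
        omega
      have hfin : {t : ℝ | ∑ k ∈ insert a S, c k * exp (k * t) = 0}.Finite := by
        by_contra hinf
        obtain ⟨s, hs, hsc⟩ := Set.Infinite.exists_subset_card_eq hinf (S.card + 1)
        have := hb s (fun t ht => hs ht)
        omega
      refine ⟨hfin.toFinset, fun t => by simp, ?_⟩
      rw [Finset.card_insert_of_notMem ha]
      have := hb hfin.toFinset (fun t ht => by simpa using ht)
      omega
    · push Not at h
      obtain ⟨k, hk, hck⟩ := hc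
      have hka : k = a := by
        rcases Finset.mem_insert.1 hk with h1 | h1
        · exact h1
        · exact absurd (h k h1) hck
      subst hka
      refine ⟨∅, fun t => ?_, by simp [Finset.card_insert_of_notMem ha]⟩
      rw [Finset.sum_insert ha, Finset.sum_eq_zero (fun j hj => by rw [h j hj, zero_mul])]
      simp [hck]

lemma expSum_simple (S s : Finset ℝ) (c : ℝ → ℝ) (hc : ∃ k ∈ S, c k ≠ 0)
    (hs : ∀ t ∈ s, ∑ k ∈ S, c k * exp (k * t) = 0) (hcard : S.card ≤ s.card + 1) (t : ℝ)
    (ht : t ∈ s) : ∑ k ∈ S, c k * k * exp (k * t) ≠ 0 := by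
  intro h0
  obtain ⟨a, haS, hca⟩ := hc
  by_cases h : ∃ k ∈ S.erase a, c k ≠ 0
  · obtain ⟨k, hk, hck⟩ := h
    have hka : k - a ≠ 0 := sub_ne_zero.2 (Finset.ne_of_mem_erase hk)
    obtain ⟨T, hT, hTc⟩ := expSum_zeros (S.erase a) (fun k => c k * (k - a))
      ⟨k, hk, mul_ne_zero hck hka⟩
    have hT' : ∀ t, ∑ k ∈ S, c k * (k - a) * exp (k * t) = 0 → t ∈ T := fun t ht => by
      rw [← Finset.add_sum_erase S _ haS, sub_self, mul_zero, zero_mul, zero_add] at ht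
      exact (hT t).1 ht
    have h1 := expSum_rolle S c a T s hT' hs
    have htT : t ∈ T := hT' t (by
      have : ∑ k ∈ S, c k * (k - a) * exp (k * t)
          = ∑ k ∈ S, c k * k * exp (k * t) - a * ∑ k ∈ S, c k * exp (k * t) := by
        rw [Finset.mul_sum, ← Finset.sum_sub_distrib]
        exact Finset.sum_congr rfl fun k _ => by ring
      rw [this, h0, hs t ht]; ring)
    have h2 : (T \ s).card < T.card := Finset.card_lt_card
      (Finset.ssubset_iff_of_subset Finset.sdiff_subset |>.2 ⟨t, htT, by simp [ht]⟩)
    rw [Finset.card_erase_of_mem haS] at hTc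
    omega
  · push Not at h
    have := hs t ht
    rw [← Finset.add_sum_erase S _ haS,
      Finset.sum_eq_zero (fun j hj => by rw [h j hj, zero_mul])] at this
    simp [hca] at this

lemma expSum_exists (S s : Finset ℝ) (hcard : s.card + 1 = S.card) :
    ∃ c : ℝ → ℝ, (∀ t ∈ s, ∑ k ∈ S, c k * exp (k * t) = 0) ∧
      ∀ t ∈ s, ∑ k ∈ S, c k * k * exp (k * t) ≠ 0 := by
  classical
  let L : (S → ℝ) →ₗ[ℝ] (s → ℝ) :=
    Matrix.toLin' (Matrix.of fun (t : s) (k : S) => exp ((k : ℝ) * t))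
  have hker : LinearMap.ker L ≠ ⊥ := LinearMap.ker_ne_bot_of_finrank_lt (by
    rw [Module.finrank_fintype_fun_eq_card, Module.finrank_fintype_fun_eq_card,
      Fintype.card_coe, Fintype.card_coe]; omega)
  obtain ⟨v, hv, hv0⟩ := Submodule.exists_mem_ne_zero_of_ne_bot hker
  have hz : ∀ t ∈ s, ∑ k ∈ S, (fun k => if h : k ∈ S then v ⟨k, h⟩ else 0) k * exp (k * t) = 0 := by
    intro t ht
    have h1 := congrFun (LinearMap.mem_ker.1 hv) ⟨t, ht⟩
    simp only [L, Matrix.toLin'_apply, Matrix.mulVec, dotProduct, Matrix.of_apply,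
      Pi.zero_apply] at h1
    rw [← Finset.sum_coe_sort, ← h1]
    refine Finset.sum_congr rfl fun k _ => ?_
    simp [mul_comm]
  refine ⟨fun k => if h : k ∈ S then v ⟨k, h⟩ else 0, hz, fun t ht =>
    expSum_simple S s _ ?_ hz hcard.ge t ht⟩
  obtain ⟨k, hk⟩ := Function.ne_iff.1 hv0
  exact ⟨k, k.2, by simpa using hk⟩

end expSums

section assemble

variable {n : ℕ} {X : Fin (n + 1) → ℝ × ℝ → ℝ × ℝ} {α : Fin (n + 1) → ℝ}

/-- the combined field -/
def combField (X : Fin (n + 1) → ℝ × ℝ → ℝ × ℝ) (b : Fin (n + 1) → ℝ) (p : ℝ × ℝ) : ℝ × ℝ :=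
  ∑ j, b j • X j p

lemma combField_contDiff (hC1 : ∀ j, ContDiff ℝ 1 (X j)) (b : Fin (n + 1) → ℝ) :
    ContDiff ℝ 1 (combField X b) := by
  unfold combField
  exact ContDiff.sum fun j _ => (hC1 j).const_smul (b j)

lemma polR_comb
    (hhom : ∀ j, ∀ r : ℝ, 0 ≤ r → ∀ p : ℝ × ℝ, X j (r • p) = (r ^ (α j)) • X j p)
    (b : Fin (n + 1) → ℝ) {r : ℝ} (hr : 0 ≤ r) (θ : ℝ) :
    polR (combField X b) r θ = ∑ j, b j * polR (X j) 1 θ * r ^ (α j) := by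
  have h : ∀ j, X j (r * cos θ, r * sin θ) = (r ^ (α j)) • X j (cos θ, sin θ) := fun j => by
    rw [← hhom j r hr]; rfl
  simp only [polR, combField, Prod.fst_sum, Prod.snd_sum, h, one_mul, Prod.smul_fst, Prod.smul_snd,
    smul_eq_mul, Finset.sum_mul]
  rw [← Finset.sum_add_distrib]
  exact Finset.sum_congr rfl fun j _ => by ring

lemma polRr_comb (hC1 : ∀ j, ContDiff ℝ 1 (X j))
    (hhom : ∀ j, ∀ r : ℝ, 0 ≤ r → ∀ p : ℝ × ℝ, X j (r • p) = (r ^ (α j)) • X j p)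
    (b : Fin (n + 1) → ℝ) {r : ℝ} (hr : 0 < r) (θ : ℝ) :
    polRr (combField X b) r θ = ∑ j, b j * polR (X j) 1 θ * (α j * r ^ (α j - 1)) := by
  have h1 := polR_hasDeriv (combField_contDiff hC1 b) r θ
  have h2 : HasDerivAt (fun r : ℝ => ∑ j, b j * polR (X j) 1 θ * r ^ (α j))
      (∑ j, b j * polR (X j) 1 θ * (α j * r ^ (α j - 1))) r :=
    HasDerivAt.fun_sum fun j _ => (Real.hasDerivAt_rpow_const (Or.inl hr.ne')).const_mul _
  refine h1.unique (h2.congr_of_eventuallyEq ?_)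
  filter_upwards [lt_mem_nhds hr] with x hx
  exact polR_comb hhom b (le_of_lt hx) θ

lemma int_comb (hC1 : ∀ j, ContDiff ℝ 1 (X j)) {I : Fin (n + 1) → ℝ}
    (hI : ∀ j, I j = ∫ θ in (0:ℝ)..(2 * π),
      ((X j (cos θ, sin θ)).1 * cos θ + (X j (cos θ, sin θ)).2 * sin θ))
    (b w : Fin (n + 1) → ℝ) :
    ∫ θ in (0:ℝ)..(2 * π), ∑ j, b j * polR (X j) 1 θ * w j = ∑ j, b j * I j * w j := by
  have c1 : ∀ j, Continuous (fun θ => polR (X j) 1 θ) := fun j =>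
    (polR_cont (hC1 j)).comp (by fun_prop : Continuous fun θ : ℝ => ((1:ℝ), θ))
  have c2 : ∀ j, Continuous (fun θ => b j * polR (X j) 1 θ * w j) := fun j =>
    ((c1 j).const_mul (b j)).mul continuous_const
  rw [intervalIntegral.integral_finsetSum (fun j _ => (c2 j).intervalIntegrable _ _)]
  refine Finset.sum_congr rfl fun j _ => ?_
  rw [intervalIntegral.integral_mul_const, intervalIntegral.integral_const_mul, hI j]
  simp [polR]

end assemble

/-- Theorem 1.1, second part. If moreover all the homogeneous vector
fields `X_j` are of class `C¹`, then there are values of `a` for which the system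
`(ẋ,ẏ) = (-y,x) + ∑_j a_j X_j(x,y)` has at least `m` hyperbolic limit cycles, where
`m + 1` is the number of non-zero integrals `I_j`. -/
theorem statement1 (n : ℕ) (X : Fin (n + 1) → ℝ × ℝ → ℝ × ℝ) (α : Fin (n + 1) → ℝ)
    (hC1 : ∀ j, ContDiff ℝ 1 (X j))
    (hαpos : ∀ j, 0 ≤ α j) (hαmono : StrictMono α)
    (hhom : ∀ j, ∀ r : ℝ, 0 ≤ r → ∀ p : ℝ × ℝ, X j (r • p) = (r ^ (α j)) • X j p)
    (I : Fin (n + 1) → ℝ)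
    (hI : ∀ j, I j = ∫ θ in (0:ℝ)..(2 * π),
      ((X j (cos θ, sin θ)).1 * cos θ + (X j (cos θ, sin θ)).2 * sin θ))
    (m : ℕ) (hm : m + 1 = {j : Fin (n + 1) | I j ≠ 0}.ncard) :
    ∃ a : Fin (n + 1) → ℝ,
      HasAtLeastNHyperbolicLimitCycles
        (fun p : ℝ × ℝ => ((-p.2, p.1) : ℝ × ℝ) + ∑ j, a j • X j p) m := by
  classical
  set J : Finset (Fin (n + 1)) := Finset.univ.filter (fun j => I j ≠ 0) with hJ
  have hJc : J.card = m + 1 := by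
    rw [hm, ← Set.ncard_coe_finset]; congr 1; ext j; simp [hJ]
  set S : Finset ℝ := J.image α with hS
  have hSc : S.card = m + 1 := by rw [hS, Finset.card_image_of_injective _ hαmono.injective, hJc]
  set s : Finset ℝ := (Finset.range m).image (fun i : ℕ => (i : ℝ)) with hs
  have hsc : s.card = m := by
    rw [hs, Finset.card_image_of_injective _ Nat.cast_injective, Finset.card_range]
  obtain ⟨c, hc0, hc1⟩ := expSum_exists S s (by rw [hSc, hsc])
  set b : Fin (n + 1) → ℝ := fun j => c (α j) / I j with hb
  set Y := combField X b with hYdef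
  have hY : ContDiff ℝ 1 Y := combField_contDiff hC1 b
  have hsum : ∀ w : ℝ → ℝ, ∑ j, b j * I j * w (α j) = ∑ k ∈ S, c k * w k := fun w => by
    rw [hS, Finset.sum_image (fun x _ y _ h => hαmono.injective h), hJ, Finset.sum_filter]
    refine Finset.sum_congr rfl fun j _ => ?_
    by_cases h : I j = 0
    · simp [h]
    · simp [h, hb]
  have hexp : ∀ t k : ℝ, exp t ^ k = exp (k * t) := fun t k => by
    rw [← Real.exp_mul, mul_comm]
  have h0 : ∀ t ∈ s, ∫ θ in (0:ℝ)..(2 * π), polR Y (exp t) θ = 0 := fun t ht => by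
    refine Eq.trans ?_ ((hsum (fun k => exp (k * t))).trans (hc0 t ht))
    rw [← int_comb hC1 hI b (fun j => exp (α j * t))]
    refine intervalIntegral.integral_congr fun θ _ => ?_
    simp only [hYdef, polR_comb hhom b (Real.exp_pos t).le θ, hexp]
  have h1 : ∀ t ∈ s, ∫ θ in (0:ℝ)..(2 * π), polRr Y (exp t) θ ≠ 0 := fun t ht => by
    have e1 : ∫ θ in (0:ℝ)..(2 * π), polRr Y (exp t) θ
        = ∑ j, b j * I j * (α j * exp t ^ (α j - 1)) := by
      rw [← int_comb hC1 hI b (fun j => α j * exp t ^ (α j - 1))]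
      refine intervalIntegral.integral_congr fun θ _ => ?_
      simp only [hYdef, polRr_comb hC1 hhom b (Real.exp_pos t) θ]
    rw [e1, hsum (fun k => k * exp t ^ (k - 1))]
    intro h
    apply hc1 t ht
    have : ∑ k ∈ S, c k * k * exp (k * t) = exp t * ∑ k ∈ S, c k * (k * exp t ^ (k - 1)) := by
      rw [Finset.mul_sum]
      refine Finset.sum_congr rfl fun k _ => ?_
      have : exp (k * t) = exp t * exp t ^ (k - 1) := by
        rw [hexp, ← Real.exp_add]; congr 1; ring
      rw [this]; ring
    rw [this, h, mul_zero]
  have hmem : ∀ i : Fin m, ((i : ℕ) : ℝ) ∈ s := fun i =>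
    Finset.mem_image.2 ⟨i, Finset.mem_range.2 i.2, rfl⟩
  have hev : ∀ᶠ ε in 𝓝[>] (0:ℝ), ∀ i : Fin m, ∃ φ, IsHyperbolicLimitCycle (pertField Y ε) φ ∧
      ∀ t, |eRad (φ t) - exp ((i : ℕ) : ℝ)| < 1 / 2 :=
    eventually_all.2 fun i => main_cycle hY (Real.exp_pos _) (by norm_num) (h0 _ (hmem i))
      (h1 _ (hmem i))
  obtain ⟨ε, hε⟩ := hev.exists
  choose φ hφ hφr using hε
  refine ⟨fun j => ε * b j, φ, ?_, ?_⟩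
  · have hF : (fun p : ℝ × ℝ => ((-p.2, p.1) : ℝ × ℝ) + ∑ j, (ε * b j) • X j p)
        = pertField Y ε := by
      funext p
      simp only [pertField, hYdef, combField, Finset.smul_sum, smul_smul]
    rw [hF]
    exact hφ
  · have hsep : ∀ i j : Fin m, i < j → Set.range (φ i) ≠ Set.range (φ j) := fun i j hij h => by
      obtain ⟨t, ht⟩ : φ i 0 ∈ Set.range (φ j) := h ▸ ⟨0, rfl⟩
      have a1 := abs_lt.1 (hφr i 0)
      have a2 := abs_lt.1 (hφr j t)
      rw [ht] at a2
      have hij' : ((i : ℕ) : ℝ) + 1 ≤ ((j : ℕ) : ℝ) := by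
        have : (i : ℕ) + 1 ≤ (j : ℕ) := hij
        exact_mod_cast this
      have a3 := Real.exp_le_exp.2 hij'
      rw [Real.exp_add] at a3
      have a4 := Real.add_one_le_exp (1:ℝ)
      have a5 : 1 ≤ exp ((i : ℕ) : ℝ) := Real.one_le_exp (Nat.cast_nonneg _)
      nlinarith
    intro i j hij
    rcases lt_or_gt_of_ne hij with h | h
    · exact hsep i j h
    · exact (hsep j i h).symm
end
end
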